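/- arXiv:2602.13001 — 4 statements merged into one kernel-verified Lean document; each statement's English description precedes it below -/
import Mathlib

section
/- Let c, d, s be positive integers with d ≥ 2, 1 ≤ c, s ≤ d and gcd(cs, d) = 1, let p ≥ 5 be a prime with p ≡ s (mod d), and set α = c/d. Let r be a positive integer such that neither (1/2 + α)^{*_r} nor 1/2 + α^{*_r} has positive p-adic valuation after multiplication, i.e., (1/2+α)^{*_r} · (1/2 + α^{*_r}) ≢ 0 (mod p). Then ∑_{k=0}^{p^r−1} (2k+α) · (α)_k^3 (1/2)_k / ((1)_k^3 (1/2+α)_k) ≡ α^{*_r} p^r − ((α^{*_r})^3/(1/2+α)^{*_r}) · p^{r+2} · H^{(2)}_{α^{*_r} p − α^{*_{r−1}}} (mod p^{r+3}). -/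
noncomputable section

/-- Pochhammer symbol `(x)_n = x(x+1)⋯(x+n-1)`. -/
def poch (x : ℚ) (n : ℕ) : ℚ := ∏ i ∈ Finset.range n, (x + i)

/-- `n`-th harmonic number of order 2: `H_n^{(2)} = ∑_{k=1}^n 1/k^2`. -/
def H2 (n : ℕ) : ℚ := ∑ k ∈ Finset.Icc 1 n, (1 : ℚ) / (k : ℚ) ^ 2

/-- Least nonnegative residue of a rational `x` (with denominator coprime to `m`)
modulo `m`: the unique integer in `{0, …, m-1}` congruent to `x` mod `m`. -/
def res (m : ℕ) (x : ℚ) : ℕ := ((x.num : ZMod m) * (x.den : ZMod m)⁻¹).val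

/-- Dwork's dash operation: `x* = (x + ⟨-x⟩_p)/p`. -/
def dash (p : ℕ) (x : ℚ) : ℚ := (x + (res p (-x) : ℚ)) / p

/-- `r`-fold iterate of Dwork's dash operation, with `x^{*_0} = x`. -/
def dashIter (p r : ℕ) (x : ℚ) : ℚ := (dash p)^[r] x

/-- For rationals `u, v`, `u ≡ v (mod p^m)` means `u = v` or the `p`-adic
valuation of `u - v` is at least `m`. -/
def ratCongr (p : ℕ) (m : ℤ) (u v : ℚ) : Prop :=
  u = v ∨ m ≤ padicValRat p (u - v)

lemma poch_zero (x : ℚ) : poch x 0 = 1 := by simp [poch]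

lemma poch_succ (x : ℚ) (n : ℕ) : poch x (n + 1) = poch x n * (x + n) := by
  simp [poch, Finset.prod_range_succ]

lemma poch_succ' (x : ℚ) (n : ℕ) : poch x (n + 1) = x * poch (x + 1) n := by
  simp only [poch, Finset.prod_range_succ']
  rw [mul_comm]
  congr 1
  · simp
  · apply Finset.prod_congr rfl
    intro i _
    push_cast
    ring

lemma poch_shift (x : ℚ) (n : ℕ) : x * poch (x + 1) n = poch x n * (x + n) := by
  rw [← poch_succ', poch_succ]

lemma poch_ne_zero (x : ℚ) (n : ℕ) (h : ∀ i : ℕ, i < n → x + i ≠ 0) : poch x n ≠ 0 := by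
  rw [poch, Finset.prod_ne_zero_iff]
  intro i hi
  exact h i (Finset.mem_range.1 hi)

lemma poch_add (x : ℚ) (m n : ℕ) : poch x (m + n) = poch x m * poch (x + m) n := by
  induction n with
  | zero => simp [poch_zero]
  | succ n ih =>
    rw [← add_assoc, poch_succ, ih, poch_succ]
    push_cast
    ring

lemma poch_neg_eq_zero (N k : ℕ) (h : N < k) : poch (-(N : ℚ)) k = 0 := by
  rw [poch, Finset.prod_eq_zero_iff]
  exact ⟨N, Finset.mem_range.2 h, by simp⟩

lemma poch_one (n : ℕ) : poch 1 n = (n.factorial : ℚ) := by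
  induction n with
  | zero => simp [poch_zero]
  | succ n ih =>
    rw [poch_succ, ih, Nat.factorial_succ]
    push_cast
    ring

lemma poch_neg_nat (n k : ℕ) :
    poch (-(n : ℚ)) k = (-1) ^ k * (n.choose k : ℚ) * (k.factorial : ℚ) := by
  induction k with
  | zero => simp [poch_zero]
  | succ k ih =>
    rw [poch_succ, ih, Nat.factorial_succ]
    have h := Nat.choose_succ_right_eq n k
    rcases le_or_gt k n with hk | hk
    · have h2 : (n.choose (k + 1) : ℚ) * (k + 1) = n.choose k * (n - k) := by
        rw [← Nat.cast_sub hk]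
        exact_mod_cast h
      push_cast
      linear_combination (-1) ^ k * (k.factorial : ℚ) * h2
    · rw [Nat.choose_eq_zero_of_lt hk, Nat.choose_eq_zero_of_lt (by omega : n < k + 1)]
      simp

/-- reflection -/
lemma poch_reflect (x : ℚ) (n : ℕ) : poch (1 - x - n) n = (-1) ^ n * poch x n := by
  induction n with
  | zero => simp [poch_zero]
  | succ n ih =>
    rw [poch_succ']
    have : (1 - x - ((n + 1 : ℕ) : ℚ) + 1) = 1 - x - n := by push_cast; ring
    rw [this, ih, poch_succ]
    push_cast
    ring

/-- Saalschütz, polynomial form -/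
lemma saal_poly (A B C : ℚ) (n : ℕ) :
    ∑ k ∈ Finset.range (n + 1), (n.choose k : ℚ) * poch A k * poch B k *
      poch (C - A - B) (n - k) * poch (C + k) (n - k) = poch (C - A) n * poch (C - B) n := by
  induction n with
  | zero => simp [poch_zero]
  | succ n ih =>
    set g : ℕ → ℚ := fun k => (if k = 0 then 0 else (n.choose (k - 1) : ℚ)) * poch A k * poch B k *
      poch (C - A - B) (n + 1 - k) * poch (C + k - 1) (n + 1 - k) with hg
    have key : ∀ k ∈ Finset.range (n + 2), ((n + 1).choose k : ℚ) * poch A k * poch B k *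
      poch (C - A - B) (n + 1 - k) * poch (C + k) (n + 1 - k) =
      (C - A + n) * (C - B + n) * ((n.choose k : ℚ) * poch A k * poch B k *
      poch (C - A - B) (n - k) * poch (C + k) (n - k)) - (g (k + 1) - g k) := by
      intro k hk
      rw [Finset.mem_range] at hk
      rcases Nat.eq_zero_or_pos k with h0 | h0
      · subst h0
        simp only [hg]
        simp only [Nat.choose_zero_right, poch_zero, Nat.sub_zero, Nat.cast_zero, add_zero, zero_add,
          if_true, Nat.add_sub_cancel]
        simp only [poch_succ, poch_zero]
        push_cast
        simp
        ring
      · obtain ⟨j, rfl⟩ : ∃ j, k = j + 1 := ⟨k - 1, by omega⟩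
        rcases Nat.lt_or_ge j n with hj | hj
        · obtain ⟨m, rfl⟩ : ∃ m, n = j + 1 + m := ⟨n - (j + 1), by omega⟩
          have e1 : j + 1 + m + 1 - (j + 1) = m + 1 := by omega
          have e2 : j + 1 + m - (j + 1) = m := by omega
          have e3 : j + 1 + m + 1 - (j + 1 + 1) = m := by omega
          simp only [hg, e1, e2, e3]
          have e4 : j + 1 + 1 - 1 = j + 1 := rfl
          have e5 : j + 1 - 1 = j := rfl
          simp only [e4, e5]
          have hc : ((j + 1 + m).choose j : ℚ) * (m + 1) = ((j + 1 + m).choose (j + 1) : ℚ) * (j + 1) := by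
            have := Nat.choose_succ_right_eq (j + 1 + m) j
            rw [show j + 1 + m - j = m + 1 by omega] at this
            exact_mod_cast this.symm
          have hp : ((j + 1 + m + 1).choose (j + 1) : ℚ) = (j + 1 + m).choose j + (j + 1 + m).choose (j + 1) := by
            exact_mod_cast Nat.choose_succ_succ (j + 1 + m) j
          rw [hp]
          have q1 := poch_succ' (C + ((j + 1 : ℕ) : ℚ) - 1) m
          rw [sub_add_cancel] at q1
          have q2 : (C + ((j + 1 + 1 : ℕ) : ℚ) - 1) = C + ((j + 1 : ℕ) : ℚ) := by push_cast; ring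
          rw [q2, q1]
          simp only [poch_succ]
          simp only [Nat.succ_ne_zero, if_false]
          push_cast
          generalize poch A j = a
          generalize poch B j = b
          generalize poch (C - A - B) m = d
          generalize poch (C + (↑j + 1)) m = e
          generalize ((j + 1 + m).choose j : ℚ) = c1 at *
          generalize ((j + 1 + m).choose (j + 1) : ℚ) = c2 at *
          linear_combination a * (A + j) * b * (B + j) * d * (C - A - B + m) * e * hc
        · have : j = n := by omega
          subst this
          simp only [hg]
          simp [poch_zero]
    rw [Finset.sum_congr rfl key, Finset.sum_sub_distrib, Finset.sum_range_sub, ← Finset.mul_sum,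
      Finset.sum_range_succ, ih]
    simp only [hg]
    simp [poch_succ]
    ring

lemma poch_split_reflect (x : ℚ) (n k : ℕ) (hk : k ≤ n) :
    poch x (n - k) * poch (1 - x - n) k = (-1) ^ k * poch x n := by
  obtain ⟨m, rfl⟩ : ∃ m, n = m + k := ⟨n - k, by omega⟩
  rw [Nat.add_sub_cancel, poch_add]
  have := poch_reflect (x + m) k
  rw [show 1 - (x + m) - (k : ℚ) = 1 - x - ((m + k : ℕ) : ℚ) by push_cast; ring] at this
  rw [this]
  ring

/-- Saalschütz, quotient form -/
lemma saal (A B C E : ℚ) (n : ℕ) (hE : E = 1 + A + B - C - n) (hC : ∀ i : ℕ, C + i ≠ 0)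
    (hE0 : ∀ i : ℕ, i < n → E + i ≠ 0) :
    (∑ k ∈ Finset.range (n + 1), poch A k * poch B k * poch (-(n : ℚ)) k /
      (poch 1 k * poch C k * poch E k)) * (poch C n * poch (C - A - B) n)
      = poch (C - A) n * poch (C - B) n := by
  rw [← saal_poly, Finset.sum_mul]
  apply Finset.sum_congr rfl
  intro k hk
  have hkn : k ≤ n := by
    rw [Finset.mem_range] at hk
    omega
  have h1 := poch_split_reflect (C - A - B) n k hkn
  rw [show 1 - (C - A - B) - (n : ℚ) = E by rw [hE]; ring] at h1
  have h2 : poch C n = poch C k * poch (C + k) (n - k) := by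
    rw [← poch_add]
    congr 1
    omega
  have n1 : poch C k ≠ 0 := poch_ne_zero _ _ (fun i _ => hC i)
  have n2 : poch E k ≠ 0 := poch_ne_zero _ _ (fun i hi => hE0 i (by omega))
  have n3 : (k.factorial : ℚ) ≠ 0 := by exact_mod_cast k.factorial_ne_zero
  rw [poch_neg_nat, poch_one, h2]
  field_simp
  linear_combination -(poch A k * poch B k * (n.choose k : ℚ) * poch (C + k) (n - k)) * h1

/-- first use of Saalschütz -/
lemma saal1 (a x : ℚ) (m : ℕ) (hx1 : ∀ i : ℕ, 1 - x + i ≠ 0) (hx2 : ∀ i : ℕ, 1 + x + i ≠ 0) :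
    ∑ k ∈ Finset.range (m + 1), poch (1 - a) k * poch (a + m) k * poch (-(m : ℚ)) k /
      (poch 1 k * poch (1 - x) k * poch (1 + x) k) =
      poch (a + x) m * poch (a - x) m / (poch (1 - x) m * poch (1 + x) m) := by
  have h := saal (1 - a) (a + m) (1 - x) (1 + x) m (by ring) hx1 (fun i _ => hx2 i)
  have e1 : (1 - x - (1 - a) - (a + m) : ℚ) = 1 - (1 + x) - m := by ring
  have e2 : (1 - x - (a + m) : ℚ) = 1 - (a + x) - m := by ring
  have e3 : (1 - x - (1 - a) : ℚ) = a - x := by ring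
  rw [e1, e2, e3, poch_reflect, poch_reflect] at h
  have n1 : poch (1 - x) m ≠ 0 := poch_ne_zero _ _ (fun i _ => hx1 i)
  have n2 : poch (1 + x) m ≠ 0 := poch_ne_zero _ _ (fun i _ => hx2 i)
  have n3 : ((-1 : ℚ)) ^ m ≠ 0 := by simp
  rw [eq_div_iff (mul_ne_zero n1 n2)]
  apply mul_right_cancel₀ n3
  linear_combination h

def Cc (a : ℚ) (n : ℕ) : ℚ := poch a (n + 1) * poch (3 / 2) n / (poch 1 n * poch (1 / 2 + a) n)

lemma one_add_ne (i : ℕ) : (1 : ℚ) + i ≠ 0 := by positivity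

/-- truncated Whipple transformation -/
lemma whipple (a x : ℚ) (n : ℕ) (ha : 0 < a) (hx1 : ∀ i : ℕ, 1 - x + i ≠ 0)
    (hx2 : ∀ i : ℕ, 1 + x + i ≠ 0) :
    ∑ k ∈ Finset.range (n + 1), (2 * (k : ℚ) + a) * (poch a k * poch (a + x) k * poch (a - x) k *
      poch (1 / 2) k / (poch 1 k * poch (1 - x) k * poch (1 + x) k * poch (1 / 2 + a) k)) =
    Cc a n * ∑ k ∈ Finset.range (n + 1), poch (1 - a) k * poch (a + n + 1) k * poch (-(n : ℚ)) k /
      (poch 1 k * poch (1 - x) k * poch (1 + x) k * (2 * k + 1)) := by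
  induction n with
  | zero => simp [Cc, poch_zero, poch_succ]
  | succ n ih =>
    rw [Finset.sum_range_succ, ih]
    have hs := saal1 a x (n + 1) hx1 hx2
    have hext : ∑ k ∈ Finset.range (n + 1), poch (1 - a) k * poch (a + n + 1) k * poch (-(n : ℚ)) k /
      (poch 1 k * poch (1 - x) k * poch (1 + x) k * (2 * k + 1)) =
      ∑ k ∈ Finset.range (n + 1 + 1), poch (1 - a) k * poch (a + n + 1) k * poch (-(n : ℚ)) k /
      (poch 1 k * poch (1 - x) k * poch (1 + x) k * (2 * k + 1)) := by
      rw [Finset.sum_range_succ _ (n + 1), poch_neg_eq_zero n (n + 1) (by omega)]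
      simp
    have hb : ∀ i : ℕ, (1 / 2 + a + i : ℚ) ≠ 0 := fun i => by positivity
    have nb : ∀ k, poch (1 / 2 + a) k ≠ 0 := fun k => poch_ne_zero _ _ (fun i _ => hb i)
    have n0 : ∀ k, poch 1 k ≠ 0 := fun k => poch_ne_zero _ _ (fun i _ => one_add_ne i)
    have n1 : ∀ k, poch (1 - x) k ≠ 0 := fun k => poch_ne_zero _ _ (fun i _ => hx1 i)
    have n2 : ∀ k, poch (1 + x) k ≠ 0 := fun k => poch_ne_zero _ _ (fun i _ => hx2 i)
    have hstep : ∀ k ∈ Finset.range (n + 1 + 1),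
      Cc a (n + 1) * (poch (1 - a) k * poch (a + (n + 1 : ℕ) + 1) k * poch (-((n + 1 : ℕ) : ℚ)) k /
        (poch 1 k * poch (1 - x) k * poch (1 + x) k * (2 * k + 1))) =
      Cc a n * (poch (1 - a) k * poch (a + n + 1) k * poch (-(n : ℚ)) k /
        (poch 1 k * poch (1 - x) k * poch (1 + x) k * (2 * k + 1))) +
      Cc a n * (a + 2 * n + 2) / (2 * (n + 1) * (1 / 2 + a + n)) *
      (poch (1 - a) k * poch (a + (n + 1 : ℕ)) k * poch (-((n + 1 : ℕ) : ℚ)) k /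
      (poch 1 k * poch (1 - x) k * poch (1 + x) k)) := by
      intro k _
      have hC : Cc a (n + 1) = Cc a n * ((a + n + 1) * (3 / 2 + n) / ((n + 1) * (1 / 2 + a + n))) := by
        unfold Cc
        rw [poch_succ a (n + 1), poch_succ (3 / 2) n, poch_succ 1 n, poch_succ (1 / 2 + a) n,
          add_comm (1 : ℚ) (n : ℚ)]
        have := hb n
        have := nb n
        have := n0 n
        have h1n : (n : ℚ) + 1 ≠ 0 := by positivity
        push_cast
        field_simp
        ring
      have q1 := poch_shift (a + n + 1) k
      have q2 := poch_shift (-((n + 1 : ℕ) : ℚ)) k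
      rw [show -((n + 1 : ℕ) : ℚ) + 1 = -(n : ℚ) by push_cast; ring] at q2
      rw [show a + ((n + 1 : ℕ) : ℚ) + 1 = a + n + 1 + 1 by push_cast; ring,
        show a + ((n + 1 : ℕ) : ℚ) = a + n + 1 by push_cast; ring, hC]
      have hne : (n : ℚ) + 1 ≠ 0 := by positivity
      have hne2 : a + n + 1 ≠ 0 := by positivity
      have r1 : poch (a + n + 1 + 1) k = poch (a + n + 1) k * (a + n + 1 + k) / (a + n + 1) := by
        rw [eq_div_iff hne2]
        linear_combination q1
      have r2 : poch (-(n : ℚ)) k = poch (-((n + 1 : ℕ) : ℚ)) k * (n + 1 - k) / (n + 1) := by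
        rw [eq_div_iff hne]
        push_cast at q2 ⊢
        linear_combination -q2
      rw [r1, r2]
      have hk : (2 * k + 1 : ℚ) ≠ 0 := by positivity
      have := hb n
      have := n0 k
      have := n1 k
      have := n2 k
      field_simp
      ring
    rw [hext, Finset.mul_sum, Finset.mul_sum, Finset.sum_congr rfl hstep, Finset.sum_add_distrib,
      ← Finset.mul_sum, ← Finset.mul_sum, hs]
    congr 1
    have e : poch (1 / 2) (n + 1) = poch (3 / 2) n / 2 := by
      rw [poch_succ']
      norm_num
      ring
    rw [e]
    unfold Cc
    rw [poch_succ (1 / 2 + a) n, poch_succ 1 n]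
    have := hb n
    have := nb n
    have := n0 n
    have hne : (n : ℚ) + 1 ≠ 0 := by positivity
    have hne' : 1 + (n : ℚ) ≠ 0 := by positivity
    have := n1 (n + 1)
    have := n2 (n + 1)
    push_cast
    field_simp
    ring

/-- the value at `x = a + N` -/
lemma whipple_val (a : ℚ) (N n : ℕ) (ha : 0 < a) (ha1 : a < 1) (hN : N ≤ n) :
    ∑ k ∈ Finset.range (n + 1), (2 * (k : ℚ) + a) * (poch a k * poch (a + (a + N)) k *
      poch (a - (a + N)) k *
      poch (1 / 2) k / (poch 1 k * poch (1 - (a + N)) k * poch (1 + (a + N)) k * poch (1 / 2 + a) k))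
    = a + N := by
  have hint : ∀ i : ℤ, a + i ≠ 0 := by
    intro i h
    have h1 : (i : ℚ) < 0 := by linarith
    have h2 : (-1 : ℚ) < i := by linarith
    have h3 : i < 0 := by exact_mod_cast h1
    have h4 : -1 < i := by exact_mod_cast h2
    omega
  have hx1 : ∀ i : ℕ, 1 - (a + N) + i ≠ 0 := by
    intro i h
    apply hint ((N : ℤ) - i - 1)
    push_cast
    linarith
  have hx2 : ∀ i : ℕ, 1 + (a + N) + (i : ℚ) ≠ 0 := fun i => by positivity
  have htr : ∑ k ∈ Finset.range (n + 1), (2 * (k : ℚ) + a) * (poch a k * poch (a + (a + N)) k *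
      poch (a - (a + N)) k *
      poch (1 / 2) k / (poch 1 k * poch (1 - (a + N)) k * poch (1 + (a + N)) k * poch (1 / 2 + a) k))
     = ∑ k ∈ Finset.range (N + 1), (2 * (k : ℚ) + a) * (poch a k * poch (a + (a + N)) k *
      poch (a - (a + N)) k *
      poch (1 / 2) k / (poch 1 k * poch (1 - (a + N)) k * poch (1 + (a + N)) k * poch (1 / 2 + a) k)) := by
    symm
    apply Finset.sum_subset
    · intro k
      simp only [Finset.mem_range]
      omega
    · intro k _ hk
      rw [Finset.mem_range] at hk
      rw [show a - (a + N) = -(N : ℚ) by ring, poch_neg_eq_zero N k (by omega)]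
      simp
  rw [htr, whipple a (a + N) N ha hx1 hx2]
  have h := saal (1 - a) (1 / 2) (3 / 2) (1 - (a + N)) N (by ring) (fun i => by positivity)
    (fun i _ => hx1 i)
  have nb : ∀ k, poch (1 / 2 + a) k ≠ 0 := fun k => poch_ne_zero _ _ (fun i _ => by positivity)
  have na : ∀ k, poch a k ≠ 0 := fun k => poch_ne_zero _ _ (fun i _ => by positivity)
  have n0 : ∀ k, poch 1 k ≠ 0 := fun k => poch_ne_zero _ _ (fun i _ => one_add_ne i)
  have n1 : ∀ k, poch (1 - (a + N)) k ≠ 0 := fun k => poch_ne_zero _ _ (fun i _ => hx1 i)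
  have n2 : ∀ k, poch (1 + (a + N)) k ≠ 0 := fun k => poch_ne_zero _ _ (fun i _ => hx2 i)
  have n3 : ∀ k, poch (3 / 2) k ≠ 0 := fun k => poch_ne_zero _ _ (fun i _ => by positivity)
  have n4 : ∀ k, poch (1 / 2) k ≠ 0 := fun k => poch_ne_zero _ _ (fun i _ => by positivity)
  have hsum : ∑ k ∈ Finset.range (N + 1), poch (1 - a) k * poch (a + N + 1) k * poch (-(N : ℚ)) k /
      (poch 1 k * poch (1 - (a + N)) k * poch (1 + (a + N)) k * (2 * k + 1)) =
      ∑ k ∈ Finset.range (N + 1), poch (1 - a) k * poch (1 / 2) k * poch (-(N : ℚ)) k /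
      (poch 1 k * poch (3 / 2) k * poch (1 - (a + N)) k) := by
    apply Finset.sum_congr rfl
    intro k _
    have hs := poch_shift (1 / 2) k
    norm_num at hs
    have r : poch (3 / 2) k = poch (1 / 2) k * (2 * k + 1) := by linear_combination 2 * hs
    rw [r, show a + N + 1 = 1 + (a + N) by ring]
    have := n0 k
    have := n1 k
    have := n2 k
    have := n4 k
    have hk : (2 * k + 1 : ℚ) ≠ 0 := by positivity
    field_simp
  rw [hsum]
  have e1 : (3 / 2 - (1 - a) - 1 / 2 : ℚ) = a := by ring
  have e2 : (3 / 2 - (1 - a) : ℚ) = 1 / 2 + a := by ring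
  have e3 : (3 / 2 - 1 / 2 : ℚ) = 1 := by norm_num
  rw [e1, e2, e3] at h
  unfold Cc
  rw [poch_succ]
  have := na N
  have := nb N
  have := n0 N
  have := n3 N
  rw [div_mul_eq_mul_div, div_eq_iff (mul_ne_zero (n0 N) (nb N))]
  linear_combination (a + N) * h

/-- the terminating harmonic identity -/
lemma H2_succ (n : ℕ) : H2 (n + 1) = H2 n + 1 / ((n : ℚ) + 1) ^ 2 := by
  unfold H2
  rw [Finset.sum_Icc_succ_top (by omega)]
  push_cast
  rfl

def zz (N k : ℕ) : ℚ := (-(N : ℚ) - 1 / 2) * poch (N + 1) k * poch (-(N : ℚ)) k /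
  (poch 1 k ^ 2 * (2 * k + 1))

lemma abel_id (N K : ℕ) :
    ∑ k ∈ Finset.range (K + 1), poch (N + 1) k * poch (-((N + 1 : ℕ) : ℚ)) k / poch 1 k ^ 2 * H2 k
    = poch (-(N : ℚ)) K * poch (N + 2) K / poch 1 K ^ 2 * H2 K +
      (poch (-(N : ℚ)) K * poch (N + 2) K / poch 1 K ^ 2 - 1) / ((N : ℚ) + 1) ^ 2 := by
  induction K with
  | zero => simp [poch_zero, H2]
  | succ K ih =>
    rw [Finset.sum_range_succ, ih, H2_succ]
    have q1 := poch_succ' (-((N + 1 : ℕ) : ℚ)) K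
    rw [show -((N + 1 : ℕ) : ℚ) + 1 = -(N : ℚ) by push_cast; ring] at q1
    have q2 := poch_succ' ((N : ℚ) + 1) K
    rw [show (N : ℚ) + 1 + 1 = N + 2 by ring] at q2
    rw [q1, q2]
    simp only [poch_succ]
    have n0 : poch 1 K ≠ 0 := poch_ne_zero _ _ (fun i _ => one_add_ne i)
    have h1 : (1 : ℚ) + K ≠ 0 := by positivity
    have h1' : (K : ℚ) + 1 ≠ 0 := by positivity
    have h2 : (N : ℚ) + 1 ≠ 0 := by positivity
    push_cast
    rw [add_comm (1 : ℚ) (K : ℚ)]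
    field_simp
    ring

lemma zz_sum (N K : ℕ) (h : N ≤ K) : ∑ k ∈ Finset.range (K + 1), zz N k * H2 k = H2 N := by
  induction N with
  | zero =>
    apply Finset.sum_eq_zero
    intro k _
    rcases Nat.eq_zero_or_pos k with h | h
    · subst h
      simp [H2]
    · rw [zz, poch_neg_eq_zero 0 k h]
      simp
  | succ N ih =>
    have ih := ih (by omega)
    have ha := abel_id N K
    rw [poch_neg_eq_zero N K (by omega)] at ha
    have key : ∀ k ∈ Finset.range (K + 1), zz (N + 1) k * H2 k = zz N k * H2 k -
      poch (N + 1) k * poch (-((N + 1 : ℕ) : ℚ)) k / poch 1 k ^ 2 * H2 k := by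
      intro k _
      rw [← sub_mul]
      congr 1
      unfold zz
      have q1 := poch_shift (-((N + 1 : ℕ) : ℚ)) k
      rw [show -((N + 1 : ℕ) : ℚ) + 1 = -(N : ℚ) by push_cast; ring] at q1
      have q2 := poch_shift ((N : ℚ) + 1) k
      have n0 : poch 1 k ≠ 0 := poch_ne_zero _ _ (fun i _ => one_add_ne i)
      have h2 : (N : ℚ) + 1 ≠ 0 := by positivity
      have hk : (2 * k + 1 : ℚ) ≠ 0 := by positivity
      have r1 : poch (-(N : ℚ)) k = poch (-((N + 1 : ℕ) : ℚ)) k * (N + 1 - k) / (N + 1) := by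
        rw [eq_div_iff h2]
        push_cast at q1 ⊢
        linear_combination -q1
      have r2 : poch (((N + 1 : ℕ) : ℚ) + 1) k = poch (N + 1) k * (N + 1 + k) / (N + 1) := by
        rw [eq_div_iff h2]
        push_cast
        linear_combination q2
      rw [r1, r2]
      push_cast
      field_simp
      ring
    rw [Finset.sum_congr rfl key, Finset.sum_sub_distrib, ih, ha, H2_succ]
    ring

/-- `p`-integral rationals -/
def RR (p : ℕ) [hp : Fact p.Prime] : Subring ℚ where
  carrier := {x | ∃ a b : ℤ, ¬ (p : ℤ) ∣ b ∧ x * b = a}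
  mul_mem' := by
    rintro x y ⟨a, b, hb, h⟩ ⟨c, d, hd, h'⟩
    refine ⟨a * c, b * d, ?_, ?_⟩
    · intro hh
      rcases (Nat.prime_iff_prime_int.1 hp.out).dvd_or_dvd hh with h1 | h1
      · exact hb h1
      · exact hd h1
    · push_cast
      rw [← h, ← h']
      ring
  one_mem' := ⟨1, 1, by
    intro h
    exact (Nat.prime_iff_prime_int.1 hp.out).not_dvd_one h, by simp⟩
  add_mem' := by
    rintro x y ⟨a, b, hb, h⟩ ⟨c, d, hd, h'⟩
    refine ⟨a * d + c * b, b * d, ?_, ?_⟩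
    · intro hh
      rcases (Nat.prime_iff_prime_int.1 hp.out).dvd_or_dvd hh with h1 | h1
      · exact hb h1
      · exact hd h1
    · push_cast
      rw [← h, ← h']
      ring
  zero_mem' := ⟨0, 1, by
    intro h
    exact (Nat.prime_iff_prime_int.1 hp.out).not_dvd_one h, by simp⟩
  neg_mem' := by
    rintro x ⟨a, b, hb, h⟩
    exact ⟨-a, b, hb, by push_cast; rw [← h]; ring⟩

def Dv (p : ℕ) [Fact p.Prime] (m : ℕ) (x : ℚ) : Prop := ∃ y ∈ RR p, x = (p : ℚ) ^ m * y

section padic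

variable {p : ℕ} [hp : Fact p.Prime]

lemma p_ne : (p : ℚ) ≠ 0 := by exact_mod_cast hp.out.ne_zero

lemma mem_inv_int (b : ℤ) (h : ¬ (p : ℤ) ∣ b) : (1 : ℚ) / b ∈ RR p := by
  refine ⟨1, b, h, ?_⟩
  have : (b : ℚ) ≠ 0 := by
    intro h0
    apply h
    have : b = 0 := by exact_mod_cast h0
    simp [this]
  field_simp
  simp

lemma mem_inv_nat (b : ℕ) (h : ¬ p ∣ b) : (1 : ℚ) / b ∈ RR p := by
  have := mem_inv_int (p := p) (b : ℤ) (by exact_mod_cast h)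
  simpa using this

lemma nat_mem (n : ℕ) : (n : ℚ) ∈ RR p := natCast_mem _ n

lemma int_mem (n : ℤ) : (n : ℚ) ∈ RR p := intCast_mem _ n

lemma Dv_zero_iff (x : ℚ) : Dv p 0 x ↔ x ∈ RR p := by
  simp [Dv]

lemma Dv.mul {m n : ℕ} {x y : ℚ} (h : Dv p m x) (h' : Dv p n y) : Dv p (m + n) (x * y) := by
  obtain ⟨a, ha, rfl⟩ := h
  obtain ⟨b, hb, rfl⟩ := h'
  exact ⟨a * b, mul_mem ha hb, by ring⟩

lemma Dv.mulR {m : ℕ} {x y : ℚ} (h : Dv p m x) (h' : y ∈ RR p) : Dv p m (x * y) :=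
  h.mul ((Dv_zero_iff y).2 h')

lemma Dv.mulL {m : ℕ} {x y : ℚ} (h : Dv p m x) (h' : y ∈ RR p) : Dv p m (y * x) := by
  rw [mul_comm]
  exact h.mulR h'

lemma Dv.add {m : ℕ} {x y : ℚ} (h : Dv p m x) (h' : Dv p m y) : Dv p m (x + y) := by
  obtain ⟨a, ha, rfl⟩ := h
  obtain ⟨b, hb, rfl⟩ := h'
  exact ⟨a + b, add_mem ha hb, by ring⟩

lemma Dv.neg {m : ℕ} {x : ℚ} (h : Dv p m x) : Dv p m (-x) := by
  obtain ⟨a, ha, rfl⟩ := h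
  exact ⟨-a, neg_mem ha, by ring⟩

lemma Dv.sub {m : ℕ} {x y : ℚ} (h : Dv p m x) (h' : Dv p m y) : Dv p m (x - y) := by
  rw [sub_eq_add_neg]
  exact h.add h'.neg

lemma Dv.mono {m n : ℕ} {x : ℚ} (h : Dv p m x) (hn : n ≤ m) : Dv p n x := by
  obtain ⟨a, ha, rfl⟩ := h
  refine ⟨(p : ℚ) ^ (m - n) * a, mul_mem (pow_mem (nat_mem p) _) ha, ?_⟩
  rw [← mul_assoc, ← pow_add, Nat.add_sub_cancel' hn]

lemma Dv.mem {m : ℕ} {x : ℚ} (h : Dv p m x) : x ∈ RR p :=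
  (Dv_zero_iff x).1 (h.mono (Nat.zero_le m))

lemma Dv.zero (m : ℕ) : Dv p m 0 := ⟨0, zero_mem _, by simp⟩

lemma Dv_pow (m : ℕ) : Dv p m ((p : ℚ) ^ m) := ⟨1, one_mem _, by simp⟩

lemma Dv.sum {m : ℕ} {ι : Type*} (s : Finset ι) (f : ι → ℚ) (h : ∀ i ∈ s, Dv p m (f i)) :
    Dv p m (∑ i ∈ s, f i) := by
  classical
  induction s using Finset.induction_on with
  | empty => simpa using Dv.zero m
  | insert a s ha ih =>
    rw [Finset.sum_insert ha]
    exact (h a (Finset.mem_insert_self a s)).add (ih (fun i hi => h i (Finset.mem_insert_of_mem hi)))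

lemma ratCongr_of_Dv {m : ℕ} {u v : ℚ} (h : Dv p m (u - v)) : ratCongr p m u v := by
  obtain ⟨y, ⟨a, b, hb, hy⟩, h⟩ := h
  by_cases huv : u = v
  · exact Or.inl huv
  · right
    have hne : u - v ≠ 0 := sub_ne_zero.2 huv
    have hy0 : y ≠ 0 := by
      rintro rfl
      simp at h
      exact hne h
    have hb0 : (b : ℚ) ≠ 0 := by
      intro h0
      apply hb
      have : b = 0 := by exact_mod_cast h0
      simp [this]
    have hv : padicValRat p y + padicValRat p (b : ℚ) = padicValRat p (a : ℚ) := by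
      rw [← padicValRat.mul hy0 hb0, hy]
    have hvb : padicValRat p (b : ℚ) = 0 := by
      rw [padicValRat.of_int, padicValInt.eq_zero_of_not_dvd hb]
      rfl
    have hva : 0 ≤ padicValRat p (a : ℚ) := by
      rw [padicValRat.of_int]
      positivity
    rw [h, padicValRat.mul (pow_ne_zero _ p_ne) hy0, padicValRat.pow,
      padicValRat.self hp.out.one_lt]
    omega

lemma inv_mem_of_not_Dv {x : ℚ} (hx : x ∈ RR p) (h : ¬ Dv p 1 x) : 1 / x ∈ RR p := by
  obtain ⟨a, b, hb, hxa⟩ := hx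
  have hb0 : (b : ℚ) ≠ 0 := by
    intro h0
    apply hb
    have : b = 0 := by exact_mod_cast h0
    simp [this]
  have hxe : x = a / b := by
    rw [eq_div_iff hb0, hxa]
  by_cases ha : (p : ℤ) ∣ a
  · exfalso
    apply h
    obtain ⟨c, rfl⟩ := ha
    refine ⟨c * (1 / b), mul_mem (int_mem c) (mem_inv_int b hb), ?_⟩
    rw [hxe]
    push_cast
    ring
  · rw [hxe, one_div_div, div_eq_mul_one_div]
    exact mul_mem (int_mem b) (mem_inv_int a ha)

lemma one_mul_one {x y : ℚ} (h : Dv p 1 (x - 1)) (h' : Dv p 1 (y - 1)) : Dv p 1 (x * y - 1) := by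
  have hx : x ∈ RR p := by
    have := add_mem h.mem (one_mem (RR p))
    simpa using this
  have := (h'.mulL hx).add h
  rw [show x * y - 1 = x * (y - 1) + (x - 1) by ring]
  exact this

lemma mem_of_one {x : ℚ} (h : Dv p 1 (x - 1)) : x ∈ RR p := by
  have := add_mem h.mem (one_mem (RR p))
  simpa using this

lemma prod_one {ι : Type*} (s : Finset ι) (f : ι → ℚ) (h : ∀ i ∈ s, Dv p 1 (f i - 1)) :
    Dv p 1 (∏ i ∈ s, f i - 1) := by
  classical
  induction s using Finset.induction_on with
  | empty => simpa using Dv.zero 1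
  | insert a s ha ih =>
    rw [Finset.prod_insert ha]
    exact one_mul_one (h a (Finset.mem_insert_self a s))
      (ih (fun i hi => h i (Finset.mem_insert_of_mem hi)))

lemma not_Dv_one_one : ¬ Dv p 1 (1 : ℚ) := by
  rintro ⟨y, ⟨a, b, hb, hy⟩, h⟩
  apply hb
  refine ⟨a, ?_⟩
  have : (b : ℚ) = p * a := by
    rw [← hy]
    linear_combination (b : ℚ) * h
  exact_mod_cast this

lemma invD_one {x : ℚ} (h : Dv p 1 (x - 1)) : x ≠ 0 ∧ Dv p 1 (1 / x - 1) := by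
  have hx : x ∈ RR p := mem_of_one h
  have hn : ¬ Dv p 1 x := by
    intro h1
    have := h1.sub h
    rw [sub_sub_cancel] at this
    exact not_Dv_one_one this
  have h0 : x ≠ 0 := by
    rintro rfl
    exact hn (Dv.zero 1)
  refine ⟨h0, ?_⟩
  have := (h.mulR (inv_mem_of_not_Dv hx hn)).neg
  rw [show 1 / x - 1 = -((x - 1) * (1 / x)) by field_simp; ring]
  exact this

/-- `q/y` is integral when `0 < y < p q` -/
lemma q_div_mem (r y : ℕ) (hy : 0 < y) (hlt : y < p ^ (r + 1)) :
    (p : ℚ) ^ r / y ∈ RR p := by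
  obtain ⟨e, m, hm, rfl⟩ := Nat.exists_eq_pow_mul_and_not_dvd hy.ne' p hp.out.ne_one
  have he : e ≤ r := by
    by_contra hcon
    have h1 : p ^ (r + 1) ≤ p ^ e := Nat.pow_le_pow_right hp.out.pos (by omega)
    have h2 : 1 ≤ m := Nat.pos_of_ne_zero (by rintro rfl; simp at hm)
    nlinarith
  have hm0 : (m : ℚ) ≠ 0 := by
    intro h0
    apply hm
    have : m = 0 := by exact_mod_cast h0
    simp [this]
  have : (p : ℚ) ^ r / ((p ^ e * m : ℕ) : ℚ) = (p : ℚ) ^ (r - e) * (1 / m) := by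
    have hpe : (p : ℚ) ^ e ≠ 0 := pow_ne_zero _ p_ne
    rw [← Nat.sub_add_cancel he, pow_add]
    push_cast
    rw [Nat.add_sub_cancel]
    field_simp
  rw [this]
  exact mul_mem (pow_mem (nat_mem p) _) (mem_inv_nat m hm)

/-- `q/y` is divisible by `p` when `q` does not divide `y` -/
lemma q_div_Dv (r y : ℕ) (hndvd : ¬ p ^ r ∣ y) : Dv p 1 ((p : ℚ) ^ r / y) := by
  have hy : y ≠ 0 := by
    rintro rfl
    simp at hndvd
  obtain ⟨e, m, hm, rfl⟩ := Nat.exists_eq_pow_mul_and_not_dvd hy p hp.out.ne_one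
  have he : e < r := by
    by_contra hcon
    exact hndvd (Dvd.dvd.mul_right (pow_dvd_pow p (by omega)) m)
  have hm0 : (m : ℚ) ≠ 0 := by
    intro h0
    apply hm
    have : m = 0 := by exact_mod_cast h0
    simp [this]
  have : (p : ℚ) ^ r / ((p ^ e * m : ℕ) : ℚ) = (p : ℚ) ^ 1 * ((p : ℚ) ^ (r - e - 1) * (1 / m)) := by
    have hpe : (p : ℚ) ^ e ≠ 0 := pow_ne_zero _ p_ne
    obtain ⟨t, rfl⟩ : ∃ t, r = e + t + 1 := ⟨r - e - 1, by omega⟩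
    rw [show e + t + 1 - e - 1 = t by omega]
    push_cast
    field_simp
    ring
  rw [this]
  exact ⟨_, mul_mem (pow_mem (nat_mem p) _) (mem_inv_nat m hm), rfl⟩

lemma q_div_Dv_lt (r y : ℕ) (hy : 0 < y) (hlt : y < p ^ r) : Dv p 1 ((p : ℚ) ^ r / y) :=
  q_div_Dv r y (fun h => by have := Nat.le_of_dvd hy h; omega)

/-- full Pochhammer block -/
lemma poch_block (r N : ℕ) (x z : ℚ) (hN : N < p ^ r) (hz : z ∈ RR p)
    (hx : x + N = z * (p : ℚ) ^ r) :
    ∃ v : ℚ, Dv p 1 (v - 1) ∧ poch x (p ^ r) = z * (p : ℚ) ^ r * poch 1 (p ^ r - 1) * v := by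
  obtain ⟨M, hM⟩ : ∃ M, p ^ r = N + 1 + M := ⟨p ^ r - (N + 1), by omega⟩
  have hMq : (p : ℚ) ^ r = N + 1 + M := by exact_mod_cast hM
  set q : ℚ := (p : ℚ) ^ r with hq
  refine ⟨(∏ i ∈ Finset.range N, (x + i) / (M + 1 + i)) *
    ∏ i ∈ Finset.range M, (x + (N + 1) + i) / (1 + i), ?_, ?_⟩
  · apply one_mul_one
    · apply prod_one
      intro i hi
      rw [Finset.mem_range] at hi
      have h0 : (M + 1 + i : ℚ) ≠ 0 := by positivity
      have : (x + i) / (M + 1 + i) - 1 = (z - 1) * (q / ((M + 1 + i : ℕ) : ℚ)) := by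
        push_cast
        field_simp
        linear_combination hx + hMq
      rw [this]
      exact (q_div_Dv_lt r _ (by omega) (by omega)).mulL (sub_mem hz (one_mem _))
    · apply prod_one
      intro i hi
      rw [Finset.mem_range] at hi
      have h0 : (1 + i : ℚ) ≠ 0 := by positivity
      have : (x + (N + 1) + i) / (1 + i) - 1 = z * (q / ((1 + i : ℕ) : ℚ)) := by
        push_cast
        field_simp
        linear_combination hx
      rw [this]
      exact (q_div_Dv_lt r _ (by omega) (by omega)).mulL hz
  · have e : p ^ r - 1 = M + N := by omega
    rw [e, hM, poch_add, poch_succ, hx, poch_add 1 M N, Finset.prod_div_distrib,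
      Finset.prod_div_distrib]
    have e1 : ∏ i ∈ Finset.range N, (x + (i : ℚ)) = poch x N := rfl
    have e2 : ∏ i ∈ Finset.range M, (x + ((N : ℚ) + 1) + (i : ℚ)) = poch (x + (N + 1)) M := rfl
    have e3 : ∏ i ∈ Finset.range M, ((1 : ℚ) + (i : ℚ)) = poch 1 M := rfl
    have e4 : ∏ i ∈ Finset.range N, ((M : ℚ) + 1 + (i : ℚ)) = poch (1 + M) N := by
      rw [add_comm (M : ℚ) 1]
      rfl
    rw [e1, e2, e3, e4]
    have n1 : poch 1 M ≠ 0 := poch_ne_zero _ _ (fun i _ => by positivity)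
    have n2 : poch (1 + M) N ≠ 0 := poch_ne_zero _ _ (fun i _ => by positivity)
    push_cast
    field_simp

/-- harmonic numbers -/
lemma H2_scale (r m : ℕ) : Dv p 1 (((p : ℚ) ^ r) ^ 2 * H2 m - H2 (m / p ^ r)) := by
  induction m with
  | zero => simpa [H2] using Dv.zero 1
  | succ m ih =>
    rw [H2_succ, Nat.succ_div]
    have hm : ((m + 1 : ℕ) : ℚ) ≠ 0 := by positivity
    split_ifs with h
    · obtain ⟨t, ht⟩ := h
      have ht' : m / p ^ r + 1 = t := by
        have h1 : (m + 1) / p ^ r = _ := Nat.succ_div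
        rw [if_pos ⟨t, ht⟩, ht, Nat.mul_div_cancel_left _ (pow_pos hp.out.pos r)] at h1
        exact h1.symm
      have ht2 : ((m / p ^ r : ℕ) : ℚ) + 1 = t := by exact_mod_cast ht'
      have ht3 : (m : ℚ) + 1 = (p : ℚ) ^ r * t := by exact_mod_cast ht
      have hpr : (p : ℚ) ^ r ≠ 0 := pow_ne_zero _ p_ne
      rw [H2_succ, ht2, ht3]
      convert ih using 1
      have ht0 : (t : ℚ) ≠ 0 := by
        intro h0
        rw [h0] at ht3
        push_cast at hm
        exact hm (by rw [ht3]; ring)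
      field_simp
      ring
    · have h1 := q_div_Dv (p := p) r (m + 1) h
      have h2 := ih.add (h1.mulR h1.mem)
      rw [add_zero]
      convert h2 using 1
      push_cast
      field_simp
      ring

lemma sq_inv_congr (y : ℚ) (h : Dv p 1 ((p : ℚ) / y)) (h' : 1 / y ∈ RR p)
   (h'' : 1 / (p - y) ∈ RR p) (hy : y ≠ 0) (hy' : p - y ≠ 0) :
   Dv p 1 (1 / (p - y) ^ 2 - 1 / y ^ 2) := by
  rw [show 1 / (p - y) ^ 2 - 1 / y ^ 2 = ((p : ℚ) / y) * ((1 / (p - y)) * (1 / (p - y)) * ((2 - p * (1 / y))))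
    by field_simp; ring]
  have h2 : (2 : ℚ) ∈ RR p := by exact_mod_cast nat_mem (p := p) 2
  exact h.mulR (mul_mem (mul_mem h'' h'') (sub_mem h2 (mul_mem (nat_mem p) h')))

lemma sq_inv_congr_nat (y : ℕ) (hy : 0 < y) (h : y < p) :
   Dv p 1 (1 / ((p : ℚ) - y) ^ 2 - 1 / (y : ℚ) ^ 2) := by
  have hn : ∀ z : ℕ, 0 < z → z < p → 1 / (z : ℚ) ∈ RR p := fun z h0 h1 =>
    mem_inv_nat z (fun hh => by have := Nat.le_of_dvd h0 hh; omega)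
  have h3 := hn (p - y) (by omega) (by omega)
  rw [Nat.cast_sub h.le] at h3
  have hlt : (y : ℚ) < p := by exact_mod_cast h
  apply sq_inv_congr
  · rw [div_eq_mul_one_div]
    have := Dv_pow (p := p) 1
    rw [pow_one] at this
    exact this.mulR (hn y hy h)
  · exact hn y hy h
  · exact h3
  · positivity
  · linarith

lemma H2_half (h5 : 5 ≤ p) (h : ℕ) (hh : p = 2 * h + 1) : Dv p 1 (H2 h) := by
  have hq : (p : ℚ) = 2 * h + 1 := by exact_mod_cast hh
  have eH : ∀ m, H2 m = ∑ k ∈ Finset.range m, 1 / ((k : ℚ) + 1) ^ 2 := by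
    intro m
    induction m with
    | zero => simp [H2]
    | succ m ih => rw [H2_succ, ih, Finset.sum_range_succ]
  have a1 : H2 (2 * h) = ∑ k ∈ Finset.range h, (1 / ((k : ℚ) + 1) ^ 2 + 1 / ((p : ℚ) - (k + 1 : ℕ)) ^ 2) := by
    rw [eH, two_mul, Finset.sum_range_add, Finset.sum_add_distrib]
    congr 1
    rw [← Finset.sum_range_reflect]
    apply Finset.sum_congr rfl
    intro k hk
    rw [Finset.mem_range] at hk
    rw [hq, show h - 1 - k = h - (k + 1) by omega]
    push_cast [Nat.cast_sub (show k + 1 ≤ h by omega)]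
    congr 2
    ring
  have a2 : ∀ m : ℕ, H2 (2 * m) = ∑ k ∈ Finset.range m, (1 / ((2 * (k + 1) : ℕ) : ℚ) ^ 2 +
      1 / ((2 * k + 1 : ℕ) : ℚ) ^ 2) := by
    intro m
    induction m with
    | zero => simp [H2]
    | succ m ih =>
      rw [Finset.sum_range_succ, ← ih, show 2 * (m + 1) = 2 * m + 1 + 1 by ring, H2_succ, H2_succ]
      push_cast
      ring
  have a3 : H2 (2 * h) = ∑ k ∈ Finset.range h, (1 / ((2 * (k + 1) : ℕ) : ℚ) ^ 2 +
      1 / ((p : ℚ) - ((2 * (k + 1) : ℕ) : ℚ)) ^ 2) := by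
    rw [a2, Finset.sum_add_distrib, Finset.sum_add_distrib]
    congr 1
    rw [← Finset.sum_range_reflect]
    apply Finset.sum_congr rfl
    intro k hk
    rw [Finset.mem_range] at hk
    rw [hq, show h - 1 - k = h - (k + 1) by omega]
    push_cast [Nat.cast_sub (show k + 1 ≤ h by omega)]
    congr 2
    ring
  have b1 : Dv p 1 (H2 (2 * h) - 2 * H2 h) := by
    rw [a1, eH h, Finset.mul_sum, ← Finset.sum_sub_distrib]
    apply Dv.sum
    intro k hk
    rw [Finset.mem_range] at hk
    have := sq_inv_congr_nat (p := p) (k + 1) (by omega) (by omega)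
    convert this using 1
    push_cast
    ring
  have b2 : Dv p 1 (H2 (2 * h) - (1 / 2) * H2 h) := by
    rw [a3, eH h, Finset.mul_sum, ← Finset.sum_sub_distrib]
    apply Dv.sum
    intro k hk
    rw [Finset.mem_range] at hk
    have := sq_inv_congr_nat (p := p) (2 * (k + 1)) (by omega) (by omega)
    convert this using 1
    push_cast
    field_simp
    ring
  have h3 : (1 : ℚ) / 3 ∈ RR p := by
    have := mem_inv_nat (p := p) 3 (fun hh => by have := Nat.le_of_dvd (by norm_num) hh; omega)
    exact_mod_cast this
  have h2 : (2 : ℚ) ∈ RR p := by exact_mod_cast nat_mem (p := p) 2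
  have := (b2.sub b1).mulL (mul_mem h2 h3)
  convert this using 1
  ring

lemma den_of_mem {x : ℚ} (hx : x ∈ RR p) : ¬ p ∣ x.den := by
  obtain ⟨a, b, hb, h⟩ := hx
  intro hd
  have h1 : x.num * b = a * x.den := by
    have hden : (x.den : ℚ) ≠ 0 := by exact_mod_cast x.den_nz
    have : (x.num : ℚ) * b = a * x.den := by
      rw [← h]
      nth_rewrite 2 [← Rat.num_div_den x]
      field_simp
    exact_mod_cast this
  have h2 : (p : ℤ) ∣ x.num * b := by
    rw [h1]
    exact Dvd.dvd.mul_left (by exact_mod_cast hd) a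
  rcases (Nat.prime_iff_prime_int.1 hp.out).dvd_or_dvd h2 with h3 | h3
  · have h4 : p ∣ x.num.natAbs := Int.natCast_dvd.1 h3
    have h5 := Nat.dvd_gcd h4 hd
    rw [x.reduced] at h5
    exact hp.out.one_lt.ne' (Nat.dvd_one.1 h5)
  · exact hb h3

lemma res_spec (y : ℚ) (hy : y ∈ RR p) : res p y < p ∧ Dv p 1 (y - res p y) := by
  have : NeZero p := ⟨hp.out.ne_zero⟩
  have hd := den_of_mem hy
  refine ⟨ZMod.val_lt _, ?_⟩
  have h0 : ((y.den : ℕ) : ZMod p) ≠ 0 := by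
    rw [Ne, ZMod.natCast_eq_zero_iff]
    exact hd
  have h1 : ((res p y : ℕ) : ZMod p) = (y.num : ZMod p) * (y.den : ZMod p)⁻¹ := by
    rw [res, ZMod.natCast_zmod_val]
  have h2 : ((y.num - (res p y : ℤ) * y.den : ℤ) : ZMod p) = 0 := by
    push_cast
    rw [h1, mul_assoc, inv_mul_cancel₀ h0]
    ring
  rw [ZMod.intCast_zmod_eq_zero_iff_dvd] at h2
  obtain ⟨c, hc⟩ := h2
  refine ⟨c * (1 / y.den), mul_mem (int_mem c) (mem_inv_nat _ hd), ?_⟩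
  have hden : (y.den : ℚ) ≠ 0 := by exact_mod_cast y.den_nz
  have hc' : (y.num : ℚ) - (res p y : ℚ) * y.den = p * c := by exact_mod_cast hc
  have hy' : y = y.num / y.den := (Rat.num_div_den y).symm
  have : y - res p y = ((y.num : ℚ) - (res p y : ℚ) * y.den) / y.den := by
    rw [sub_div, ← hy']
    field_simp
  rw [this, hc']
  field_simp

lemma dash_spec (x : ℚ) (hx : x ∈ RR p) : dash p x ∈ RR p ∧
    ∃ t : ℕ, t < p ∧ dash p x * p = x + t := by
  obtain ⟨h1, y, hy, h2⟩ := res_spec (-x) (neg_mem hx)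
  have hp0 : (p : ℚ) ≠ 0 := p_ne
  constructor
  · have : dash p x = -y := by
      rw [dash, div_eq_iff hp0]
      linear_combination -h2
    rw [this]
    exact neg_mem hy
  · refine ⟨_, h1, ?_⟩
    rw [dash]
    field_simp

lemma dashIter_succ (r : ℕ) (x : ℚ) : dashIter p (r + 1) x = dash p (dashIter p r x) := by
  simp only [dashIter, Function.iterate_succ_apply']

lemma dashIter_spec (x : ℚ) (hx : x ∈ RR p) (r : ℕ) : dashIter p r x ∈ RR p ∧
    ∃ N : ℕ, N < p ^ r ∧ x + N = dashIter p r x * (p : ℚ) ^ r := by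
  induction r with
  | zero =>
    refine ⟨by simpa [dashIter] using hx, 0, by simp, by simp [dashIter]⟩
  | succ r ih =>
    obtain ⟨h1, N, hN, h2⟩ := ih
    obtain ⟨h3, t, ht, h4⟩ := dash_spec _ h1
    rw [dashIter_succ]
    refine ⟨h3, N + t * p ^ r, ?_, ?_⟩
    · rw [pow_succ]
      nlinarith
    · push_cast
      rw [pow_succ]
      linear_combination h2 - (p : ℚ) ^ r * h4

def WW (n k : ℕ) : ℕ := (2 * k).choose k * ((n + k + 1).choose (2 * k + 1) + (n + k).choose (2 * k + 1))

lemma WW_mul (n k : ℕ) : (2 * k + 1) * WW n k = (2 * n + 1) * ((2 * k).choose k * (n + k).choose (2 * k)) := by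
  unfold WW
  have h1 := Nat.add_one_mul_choose_eq (n + k) (2 * k)
  have h2 := Nat.choose_succ_right_eq (n + k) (2 * k)
  rcases le_or_gt k n with h | h
  · obtain ⟨m, rfl⟩ : ∃ m, n = k + m := ⟨n - k, by omega⟩
    rw [show k + m + k - 2 * k = m by omega] at h2
    zify at h1 h2 ⊢
    linear_combination -((2 * k).choose k : ℤ) * h1 + ((2 * k).choose k : ℤ) * h2
  · rw [Nat.choose_eq_zero_of_lt (by omega : n + k + 1 < 2 * k + 1),
      Nat.choose_eq_zero_of_lt (by omega : n + k < 2 * k + 1),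
      Nat.choose_eq_zero_of_lt (by omega : n + k < 2 * k)]
    simp

lemma poch_desc (n k : ℕ) : poch (n + 1) k * poch (-(n : ℚ)) k =
    (-1) ^ k * ((n + k).descFactorial (2 * k) : ℚ) := by
  induction k with
  | zero => simp [poch_zero]
  | succ k ih =>
    rw [poch_succ, poch_succ]
    have e : (n + (k + 1)).descFactorial (2 * (k + 1)) =
      (n + k + 1) * ((n + k - 2 * k) * (n + k).descFactorial (2 * k)) := by
      rw [show n + (k + 1) = n + k + 1 by ring, show 2 * (k + 1) = 2 * k + 1 + 1 by ring,
        Nat.succ_descFactorial_succ, Nat.descFactorial_succ]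
    rw [e]
    rcases le_or_gt k n with h | h
    · obtain ⟨m, rfl⟩ : ∃ m, n = k + m := ⟨n - k, by omega⟩
      rw [show k + m + k - 2 * k = m by omega]
      push_cast at ih ⊢
      linear_combination ((k : ℚ) + m + 1 + k) * (-(k + m) + k) * ih
    · rw [Nat.descFactorial_eq_zero_iff_lt.2 (by omega : n + k < 2 * k)] at ih ⊢
      push_cast at ih ⊢
      linear_combination ((n : ℚ) + 1 + k) * (-n + k) * ih

lemma zz_eq (n k : ℕ) : zz n k = -(1 / 2) * (-1) ^ k * WW n k := by
  unfold zz
  rw [mul_assoc (-(n : ℚ) - 1 / 2), poch_desc, poch_one]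
  have h := WW_mul n k
  have h1 : ((2 * k : ℚ) + 1) * WW n k = (2 * n + 1) * ((2 * k).choose k * (n + k).choose (2 * k)) := by
    exact_mod_cast h
  have h2 : ((n + k).descFactorial (2 * k) : ℚ) = (2 * k).factorial * (n + k).choose (2 * k) := by
    exact_mod_cast Nat.descFactorial_eq_factorial_mul_choose (n + k) (2 * k)
  have h3 : ((2 * k).choose k : ℚ) * k.factorial * k.factorial = (2 * k).factorial := by
    have := Nat.choose_mul_factorial_mul_factorial (show k ≤ 2 * k by omega)
    rw [show 2 * k - k = k by omega] at this
    exact_mod_cast this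
  have n3 : (k.factorial : ℚ) ≠ 0 := by exact_mod_cast k.factorial_ne_zero
  have hk : (2 * k + 1 : ℚ) ≠ 0 := by positivity
  rw [h2, ← h3, div_eq_iff (mul_ne_zero (pow_ne_zero 2 n3) hk)]
  linear_combination (1 / 2) * (-1) ^ k * (k.factorial : ℚ) ^ 2 * h1

lemma choose_shift (r m t : ℕ) (ht : t < p ^ r) :
    (((m + p ^ r).choose t : ℕ) : ZMod p) = ((m.choose t : ℕ) : ZMod p) := by
  rw [Nat.add_choose_eq]
  push_cast
  rw [Finset.sum_eq_single (t, 0)]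
  · simp
  · rintro ⟨i, j⟩ hij hne
    rw [Finset.HasAntidiagonal.mem_antidiagonal] at hij
    simp only at hij
    have hj : j ≠ 0 := by
      rintro rfl
      apply hne
      simp at hij
      simp [hij]
    have : p ∣ (p ^ r).choose j := hp.out.dvd_choose_pow hj (by omega)
    have h0 : (((p ^ r).choose j : ℕ) : ZMod p) = 0 := (ZMod.natCast_eq_zero_iff _ _).2 this
    simp only
    rw [h0, mul_zero]
  · intro h
    simp at h

lemma WW_big (r n k : ℕ) (hk : k < p ^ r) (h : p ^ r < 2 * k + 1) : (WW n k : ZMod p) = 0 := by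
  have := choose_shift (p := p) r (2 * k - p ^ r) k hk
  rw [Nat.sub_add_cancel (by omega), Nat.choose_eq_zero_of_lt (show 2 * k - p ^ r < k by omega)] at this
  unfold WW
  rw [Nat.cast_mul, this]
  simp

lemma WW_shift (r N k : ℕ) (hk : k < p ^ r) (h : 2 * k + 1 ≠ p ^ r) :
    (WW (N + p ^ r) k : ZMod p) = WW N k := by
  rcases Nat.lt_or_ge (p ^ r) (2 * k + 1) with h1 | h1
  · rw [WW_big r _ k hk h1, WW_big r _ k hk h1]
  · unfold WW
    have e1 := choose_shift (p := p) r (N + k + 1) (2 * k + 1) (by omega)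
    have e2 := choose_shift (p := p) r (N + k) (2 * k + 1) (by omega)
    rw [show N + p ^ r + k + 1 = N + k + 1 + p ^ r by ring, show N + p ^ r + k = N + k + p ^ r by ring]
    push_cast at e1 e2 ⊢
    rw [e1, e2]

lemma WW_bad (r N k : ℕ) (hN : N < p ^ r) (hk : k < p ^ r) (h : 2 * k + 1 ≠ p ^ r)
    (hb : p ^ r ∣ 2 * (N + p ^ r) + 1 ∨ (∃ i < k, p ^ r ∣ N + p ^ r + 1 + i) ∨
      (∃ i < k, p ^ r ∣ N + p ^ r - i)) : (WW N k : ZMod p) = 0 := by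
  rcases Nat.lt_or_ge (p ^ r) (2 * k + 1) with h1 | h1
  · exact WW_big r _ k hk h1
  have h1' : 2 * k + 1 < p ^ r := by omega
  rcases hb with hb | ⟨i, hi, hb⟩ | ⟨i, hi, hb⟩
  · rw [← WW_shift r N k hk h, ZMod.natCast_eq_zero_iff]
    by_contra hcon
    have hd : p ^ r ∣ (2 * k + 1) * WW (N + p ^ r) k := by
      rw [WW_mul]
      exact Dvd.dvd.mul_right hb _
    have hco : Nat.Coprime (p ^ r) (WW (N + p ^ r) k) :=
      Nat.Coprime.pow_left r ((Nat.Prime.coprime_iff_not_dvd hp.out).2 hcon)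
    have := Nat.le_of_dvd (by omega) (hco.dvd_of_dvd_mul_right hd)
    omega
  · have hb' : p ^ r ∣ N + 1 + i := by
      rw [show N + p ^ r + 1 + i = N + 1 + i + p ^ r by ring] at hb
      exact (Nat.dvd_add_left (dvd_refl _)).1 hb
    obtain ⟨c, hc⟩ := hb'
    have hc1 : c = 1 := by
      have : c ≠ 0 := by rintro rfl; omega
      have : c < 2 := by
        by_contra hcon
        have : p ^ r * 2 ≤ p ^ r * c := Nat.mul_le_mul_left _ (by omega)
        omega
      omega
    rw [hc1, mul_one] at hc
    unfold WW
    have e1 := choose_shift (p := p) r (k - i) (2 * k + 1) h1'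
    have e2 := choose_shift (p := p) r (k - i - 1) (2 * k + 1) h1'
    rw [show N + k + 1 = k - i + p ^ r by omega, show N + k = k - i - 1 + p ^ r by omega]
    rw [Nat.choose_eq_zero_of_lt (by omega : k - i < 2 * k + 1)] at e1
    rw [Nat.choose_eq_zero_of_lt (by omega : k - i - 1 < 2 * k + 1)] at e2
    push_cast at e1 e2 ⊢
    rw [e1, e2]
    simp
  · have hNi : N = i := by
      obtain ⟨c, hc⟩ := hb
      have h0 : c ≠ 0 := by rintro rfl; omega
      have : c < 2 := by
        by_contra hcon
        have : p ^ r * 2 ≤ p ^ r * c := Nat.mul_le_mul_left _ (by omega)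
        omega
      have hc1 : c = 1 := by omega
      rw [hc1, mul_one] at hc
      omega
    unfold WW
    rw [Nat.choose_eq_zero_of_lt (by omega : N + k + 1 < 2 * k + 1),
      Nat.choose_eq_zero_of_lt (by omega : N + k < 2 * k + 1)]
    simp

def ZZ (a q : ℚ) (k : ℕ) : ℚ := (a + q - 1 / 2) * poch (1 - a) k * poch (a + q) k /
  (poch 1 k ^ 2 * (2 * k + 1))

def rho (A q : ℚ) (n k : ℕ) : ℚ := (1 - 2 * (A + 2) * (q / (2 * n + 1 : ℕ))) *
  (∏ i ∈ Finset.range k, (1 - (A + 1) * (q / (n + 1 + i : ℕ)))) *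
  (∏ i ∈ Finset.range k, (1 - (A + 2) * (q / (n - i : ℕ))))

lemma ZZ_eq (a A : ℚ) (q N k : ℕ) (h : a + N = A * q) (hk : k < q) :
    ZZ a q k = zz (N + q) k * rho A q (N + q) k := by
  have e1 : poch (1 - a) k = poch (((N + q : ℕ) : ℚ) + 1) k *
      ∏ i ∈ Finset.range k, (1 - (A + 1) * ((q : ℚ) / (N + q + 1 + i : ℕ))) := by
    unfold poch
    rw [← Finset.prod_mul_distrib]
    apply Finset.prod_congr rfl
    intro i _
    have : ((N + q + 1 + i : ℕ) : ℚ) ≠ 0 := by positivity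
    push_cast at this ⊢
    field_simp
    linear_combination -h
  have e2 : poch (a + q) k = poch (-((N + q : ℕ) : ℚ)) k *
      ∏ i ∈ Finset.range k, (1 - (A + 2) * ((q : ℚ) / (N + q - i : ℕ))) := by
    unfold poch
    rw [← Finset.prod_mul_distrib]
    apply Finset.prod_congr rfl
    intro i hi
    have hi := Finset.mem_range.1 hi
    obtain ⟨m, hm⟩ : ∃ m, N + q = i + 1 + m := ⟨N + q - (i + 1), by omega⟩
    rw [show N + q - i = m + 1 by omega, hm]
    have hm' : (N : ℚ) + q = i + 1 + m := by exact_mod_cast hm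
    have : (m : ℚ) + 1 ≠ 0 := by positivity
    push_cast
    field_simp
    linear_combination ((m : ℚ) + 1) * (h - hm')
  have e3 : (a + q - 1 / 2) = (-((N + q : ℕ) : ℚ) - 1 / 2) *
      (1 - 2 * (A + 2) * ((q : ℚ) / (2 * (N + q) + 1 : ℕ))) := by
    have : ((2 * (N + q) + 1 : ℕ) : ℚ) ≠ 0 := by positivity
    push_cast at this ⊢
    field_simp
    linear_combination (2 + 4 * ((N : ℚ) + q)) * h
  unfold ZZ zz rho
  rw [e1, e2, e3]
  ring

lemma rho_mem (h5 : 5 ≤ p) (r N k : ℕ) (A : ℚ) (hA : A ∈ RR p) (hN : N < p ^ r) (hk : k < p ^ r) :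
    rho A ((p : ℚ) ^ r) (N + p ^ r) k ∈ RR p := by
  have hq : 5 * p ^ r ≤ p ^ (r + 1) := by
    rw [pow_succ, mul_comm]
    exact Nat.mul_le_mul_left _ h5
  have h1 := one_mem (RR p)
  have h2 : (2 : ℚ) ∈ RR p := by exact_mod_cast nat_mem (p := p) 2
  unfold rho
  refine mul_mem (mul_mem ?_ (prod_mem ?_)) (prod_mem ?_)
  · exact sub_mem h1 (mul_mem (mul_mem h2 (add_mem hA h2)) (q_div_mem r _ (by omega) (by omega)))
  · intro i hi
    have hi := Finset.mem_range.1 hi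
    exact sub_mem h1 (mul_mem (add_mem hA h1) (q_div_mem r _ (by omega) (by omega)))
  · intro i hi
    have hi := Finset.mem_range.1 hi
    exact sub_mem h1 (mul_mem (add_mem hA h2) (q_div_mem r _ (by omega) (by omega)))

lemma one_sub_one {x y : ℚ} (hx : x ∈ RR p) (h : Dv p 1 y) : Dv p 1 (1 - x * y - 1) := by
  rw [show 1 - x * y - 1 = -(x * y) by ring]
  exact (h.mulL hx).neg

lemma rho_one (r N k : ℕ) (A : ℚ) (hA : A ∈ RR p)
    (hb : ¬ (p ^ r ∣ 2 * (N + p ^ r) + 1 ∨ (∃ i < k, p ^ r ∣ N + p ^ r + 1 + i) ∨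
      (∃ i < k, p ^ r ∣ N + p ^ r - i))) :
    Dv p 1 (rho A ((p : ℚ) ^ r) (N + p ^ r) k - 1) := by
  have h1 := one_mem (RR p)
  have h2 : (2 : ℚ) ∈ RR p := by exact_mod_cast nat_mem (p := p) 2
  push Not at hb
  obtain ⟨b1, b2, b3⟩ := hb
  unfold rho
  refine one_mul_one (one_mul_one ?_ (prod_one _ _ ?_)) (prod_one _ _ ?_)
  · exact one_sub_one (mul_mem h2 (add_mem hA h2)) (q_div_Dv r _ b1)
  · intro i hi
    exact one_sub_one (add_mem hA h1) (q_div_Dv r _ (b2 i (Finset.mem_range.1 hi)))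
  · intro i hi
    exact one_sub_one (add_mem hA h2) (q_div_Dv r _ (b3 i (Finset.mem_range.1 hi)))

lemma half_mem (h5 : 5 ≤ p) : (1 / 2 : ℚ) ∈ RR p := by
  have := mem_inv_nat (p := p) 2 (fun h => by have := Nat.le_of_dvd (by norm_num) h; omega)
  exact_mod_cast this

lemma zz_mem (h5 : 5 ≤ p) (n k : ℕ) : zz n k ∈ RR p := by
  rw [zz_eq]
  exact mul_mem (mul_mem (neg_mem (half_mem h5)) (pow_mem (neg_mem (one_mem _)) k)) (nat_mem _)

lemma Dv_of_zmod (a b : ℕ) (h : (a : ZMod p) = b) : Dv p 1 ((a : ℚ) - b) := by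
  have h2 : ((a - b : ℤ) : ZMod p) = 0 := by
    push_cast
    rw [h, sub_self]
  rw [ZMod.intCast_zmod_eq_zero_iff_dvd] at h2
  obtain ⟨c, hc⟩ := h2
  refine ⟨c, int_mem c, ?_⟩
  rw [pow_one]
  exact_mod_cast hc

lemma ZZ_mem (h5 : 5 ≤ p) (r N k : ℕ) (a A : ℚ) (hA : A ∈ RR p) (hN : N < p ^ r) (hk : k < p ^ r)
    (h : a + N = A * (p : ℚ) ^ r) : ZZ a ((p : ℚ) ^ r) k ∈ RR p := by
  have := ZZ_eq a A (p ^ r) N k (by exact_mod_cast h) hk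
  push_cast at this
  rw [this]
  exact mul_mem (zz_mem h5 _ _) (rho_mem h5 r N k A hA hN hk)

lemma ZZ_congr (h5 : 5 ≤ p) (r N k : ℕ) (a A : ℚ) (hA : A ∈ RR p) (hN : N < p ^ r) (hk : k < p ^ r)
    (h : a + N = A * (p : ℚ) ^ r) (hne : 2 * k + 1 ≠ p ^ r) :
    Dv p 1 (ZZ a ((p : ℚ) ^ r) k - zz N k) := by
  have e := ZZ_eq a A (p ^ r) N k (by exact_mod_cast h) hk
  push_cast at e
  have hu : -(1 / 2 : ℚ) * (-1) ^ k ∈ RR p :=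
    mul_mem (neg_mem (half_mem h5)) (pow_mem (neg_mem (one_mem _)) k)
  have hs := Dv_of_zmod _ _ (WW_shift r N k hk hne)
  have hz : Dv p 1 (zz (N + p ^ r) k - zz N k) := by
    rw [zz_eq, zz_eq, ← mul_sub]
    exact hs.mulL hu
  rw [e]
  by_cases hb : p ^ r ∣ 2 * (N + p ^ r) + 1 ∨ (∃ i < k, p ^ r ∣ N + p ^ r + 1 + i) ∨
      (∃ i < k, p ^ r ∣ N + p ^ r - i)
  · have h0 := WW_bad r N k hN hk hne hb
    have h1 : Dv p 1 (zz N k) := by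
      have := Dv_of_zmod (p := p) _ 0 (by simpa using h0)
      rw [zz_eq]
      simpa using this.mulL hu
    have h2 : Dv p 1 (zz (N + p ^ r) k) := by
      have := hz.add h1
      simpa using this
    exact (h2.mulR (rho_mem h5 r N k A hA hN hk)).sub h1
  · have h1 := rho_one r N k A hA hb
    rw [show zz (N + p ^ r) k * rho A ((p : ℚ) ^ r) (N + p ^ r) k - zz N k =
      zz (N + p ^ r) k * (rho A ((p : ℚ) ^ r) (N + p ^ r) k - 1) + (zz (N + p ^ r) k - zz N k) by ring]
    exact (h1.mulL (zz_mem h5 _ _)).add hz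

def xi (q : ℚ) (k : ℕ) : ℚ := poch (-(q - 1)) k / poch 1 k

lemma xi_one (r k : ℕ) (hk : k < p ^ r) : Dv p 1 (xi ((p : ℚ) ^ r) k - 1) := by
  have : xi ((p : ℚ) ^ r) k = ∏ i ∈ Finset.range k, (1 - 1 * ((p : ℚ) ^ r / (i + 1 : ℕ))) := by
    unfold xi poch
    rw [← Finset.prod_div_distrib]
    apply Finset.prod_congr rfl
    intro i _
    have : (i : ℚ) + 1 ≠ 0 := by positivity
    have : (1 : ℚ) + i ≠ 0 := by positivity
    push_cast
    field_simp
    ring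
  rw [this]
  apply prod_one
  intro i hi
  have hi := Finset.mem_range.1 hi
  exact one_sub_one (one_mem _) (q_div_Dv_lt r _ (by omega) (by omega))

lemma Cc_eq (h5 : 5 ≤ p) (r N M : ℕ) (α A B : ℚ) (hA : A ∈ RR p) (hB : B ∈ RR p) (hB0 : B ≠ 0)
    (hN : N < p ^ r) (hM : M < p ^ r) (h1 : α + N = A * (p : ℚ) ^ r) (h2 : 1 / 2 + α + M = B * (p : ℚ) ^ r)
    (hα : 0 < α) :
    ∃ v, Dv p 1 (v - 1) ∧ Cc α (p ^ r - 1) = A * (p : ℚ) ^ r / B * (α + (p : ℚ) ^ r - 1 / 2) * v := by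
  have hpos : 0 < p ^ r := Nat.pow_pos hp.out.pos
  have hodd : Odd (p ^ r) := (hp.out.odd_of_ne_two (by omega)).pow
  obtain ⟨h, hh⟩ := hodd
  have hhq : (p : ℚ) ^ r = 2 * h + 1 := by exact_mod_cast hh
  obtain ⟨v1, hv1, e1⟩ := poch_block r N α A hN hA h1
  obtain ⟨v2, hv2, e2⟩ := poch_block (p := p) r h (1 / 2) (1 / 2) (by omega) (half_mem h5)
    (by rw [hhq]; ring)
  obtain ⟨v3, hv3, e3⟩ := poch_block r M (1 / 2 + α) B hM hB h2
  obtain ⟨hv30, hv3'⟩ := invD_one hv3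
  refine ⟨v1 * v2 * (1 / v3), one_mul_one (one_mul_one hv1 hv2) hv3', ?_⟩
  obtain ⟨m, hm⟩ : ∃ m, p ^ r = m + 1 := ⟨p ^ r - 1, by omega⟩
  have hmq : (p : ℚ) ^ r = m + 1 := by exact_mod_cast hm
  have hmm : p ^ r - 1 = m := by omega
  rw [hmm, hm] at e1 e2 e3
  rw [hmm]
  rw [poch_succ] at e3
  rw [poch_succ'] at e2
  rw [hmq] at e1 e2 e3 ⊢
  have hP : poch 1 m ≠ 0 := poch_ne_zero _ _ (fun i _ => one_add_ne i)
  have hL : poch (1 / 2 + α) m ≠ 0 := poch_ne_zero _ _ (fun i _ => by positivity)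
  have hm1 : (m : ℚ) + 1 ≠ 0 := by positivity
  have e2' : poch (3 / 2) m = (m + 1) * poch 1 m * v2 := by
    rw [show (1 / 2 + 1 : ℚ) = 3 / 2 by norm_num] at e2
    linear_combination 2 * e2
  unfold Cc
  rw [e1, e2']
  have e3' : α + (m + 1) - 1 / 2 = B * (m + 1) * poch 1 m * v3 / poch (1 / 2 + α) m := by
    rw [eq_div_iff hL, ← e3]
    ring
  rw [e3']
  field_simp

def GG (x : ℚ) (k : ℕ) : ℚ := poch 1 k ^ 2 / (poch (1 - x) k * poch (1 + x) k)

lemma GG_succ (x : ℚ) (k : ℕ) : GG x (k + 1) = GG x k * (1 / (1 - (x / (k + 1)) ^ 2)) := by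
  unfold GG
  simp only [poch_succ]
  have : (k : ℚ) + 1 ≠ 0 := by positivity
  have e : (1 - (x / (k + 1)) ^ 2) = (1 - x + k) * (1 + x + k) / (k + 1) ^ 2 := by
    field_simp
    ring
  rw [e, one_div_div, div_mul_div_comm]
  congr 1 <;> ring

lemma GG_congr (r k : ℕ) (A : ℚ) (hA : A ∈ RR p) (hk : k < p ^ r) :
    GG (A * (p : ℚ) ^ r) k ∈ RR p ∧ Dv p 2 ((A * (p : ℚ) ^ r) ^ 2 * H2 k) ∧
    Dv p 3 (GG (A * (p : ℚ) ^ r) k - 1 - (A * (p : ℚ) ^ r) ^ 2 * H2 k) := by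
  induction k with
  | zero =>
    refine ⟨?_, ?_, ?_⟩
    · simp [GG, poch_zero, one_mem]
    · simpa [H2] using Dv.zero 2
    · simpa [H2, GG, poch_zero] using Dv.zero 3
  | succ k ih =>
    obtain ⟨h1, h2, h3⟩ := ih (by omega)
    set x := A * (p : ℚ) ^ r with hx
    have hy : Dv p 1 (x / (k + 1)) := by
      have := (q_div_Dv_lt (p := p) r (k + 1) (by omega) hk).mulL hA
      rw [hx, mul_div_assoc]
      exact_mod_cast this
    set ε := (x / (k + 1)) ^ 2 with hε
    have hε2 : Dv p 2 ε := by
      rw [hε, pow_two]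
      exact hy.mul hy
    obtain ⟨n0, hi⟩ := invD_one (show Dv p 1 ((1 - ε) - 1) by
      rw [show 1 - ε - 1 = -ε by ring]
      exact (hε2.mono (by norm_num)).neg)
    have hi := mem_of_one hi
    have hH : x ^ 2 * H2 (k + 1) = x ^ 2 * H2 k + ε := by
      rw [H2_succ, hε, div_pow]
      ring
    rw [GG_succ, hH, ← hε]
    refine ⟨mul_mem h1 hi, h2.add hε2, ?_⟩
    have e : GG x k * (1 / (1 - ε)) - 1 - (x ^ 2 * H2 k + ε) =
      (GG x k - 1 - x ^ 2 * H2 k) + ε * (x ^ 2 * H2 k + (GG x k - 1 - x ^ 2 * H2 k)) +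
       ε * ε * (GG x k * (1 / (1 - ε))) := by
      field_simp
      ring
    rw [e]
    refine (h3.add ?_).add ?_
    · exact (hε2.mul (h2.add (h3.mono (by norm_num)))).mono (by norm_num)
    · exact ((hε2.mul hε2).mulR (mul_mem h1 hi)).mono (by norm_num)

lemma term_eq (a x : ℚ) (m k : ℕ) : (a + (m + 1) - 1 / 2) *
    (poch (1 - a) k * poch (a + m + 1) k * poch (-(m : ℚ)) k /
      (poch 1 k * poch (1 - x) k * poch (1 + x) k * (2 * k + 1))) =
    ZZ a (m + 1) k * xi (m + 1) k * GG x k := by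
  have hP : poch 1 k ≠ 0 := poch_ne_zero _ _ (fun i _ => one_add_ne i)
  unfold ZZ xi GG
  rw [show -((m : ℚ) + 1 - 1) = -(m : ℚ) by ring, show a + (m + 1 : ℚ) = a + m + 1 by ring]
  generalize poch (1 - x) k = u
  generalize poch (1 + x) k = w
  generalize poch (1 - a) k = e
  generalize poch (a + m + 1) k = f
  generalize poch (-(m : ℚ)) k = g
  generalize poch 1 k = P at hP
  rw [div_mul_div_comm, div_mul_div_comm, ← mul_div_assoc]
  rw [show (a + m + 1 - 1 / 2) * e * f * g * P ^ 2 = P ^ 2 * ((a + m + 1 - 1 / 2) * (e * f * g)) by ring,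
    show P ^ 2 * (2 * k + 1) * P * (u * w) = P ^ 2 * (P * u * w * (2 * k + 1)) by ring,
    mul_div_mul_left _ _ (pow_ne_zero 2 hP)]

lemma S_diff (α A B v q : ℚ) (N m : ℕ) (h0 : 0 < α) (h1 : α < 1) (hNm : N ≤ m) (hq : q = m + 1)
    (hA : α + N = A * q) (hC : Cc α m = A * q / B * (α + q - 1 / 2) * v) :
    ∑ k ∈ Finset.range (m + 1),
        (2 * (k : ℚ) + α) * poch α k ^ 3 * poch (1/2) k /
          (poch 1 k ^ 3 * poch (1/2 + α) k) - A * q =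
    A * q / B * (v * ∑ k ∈ Finset.range (m + 1), ZZ α q k * xi q k * (1 - GG (A * q) k)) := by
  subst hq
  have hint : ∀ i : ℤ, α + i ≠ 0 := by
    intro i h
    have h1 : (i : ℚ) < 0 := by linarith
    have h2 : (-1 : ℚ) < i := by linarith
    have h3 : i < 0 := by exact_mod_cast h1
    have h4 : -1 < i := by exact_mod_cast h2
    omega
  have hx1 : ∀ i : ℕ, 1 - (α + N) + i ≠ 0 := by
    intro i h
    apply hint ((N : ℤ) - i - 1)
    push_cast
    linarith
  have hx2 : ∀ i : ℕ, 1 + (α + N) + (i : ℚ) ≠ 0 := fun i => by positivity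
  have key : ∀ x : ℚ, Cc α m * ∑ k ∈ Finset.range (m + 1), poch (1 - α) k * poch (α + m + 1) k *
      poch (-(m : ℚ)) k / (poch 1 k * poch (1 - x) k * poch (1 + x) k * (2 * k + 1)) =
      A * (m + 1) / B * (v * ∑ k ∈ Finset.range (m + 1), ZZ α (m + 1) k * xi (m + 1) k * GG x k) := by
    intro x
    rw [hC, Finset.mul_sum, Finset.mul_sum, Finset.mul_sum]
    apply Finset.sum_congr rfl
    intro k _
    rw [← term_eq]
    ring
  have w0 := whipple α 0 m h0 (fun i => by positivity) (fun i => by positivity)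
  have w1 := whipple α (α + N) m h0 hx1 hx2
  rw [whipple_val α N m h0 h1 hNm, key, hA] at w1
  rw [key] at w0
  have e0 : ∑ k ∈ Finset.range (m + 1),
        (2 * (k : ℚ) + α) * poch α k ^ 3 * poch (1/2) k /
          (poch 1 k ^ 3 * poch (1/2 + α) k) =
     ∑ k ∈ Finset.range (m + 1), (2 * (k : ℚ) + α) * (poch α k * poch (α + 0) k * poch (α - 0) k *
      poch (1 / 2) k / (poch 1 k * poch (1 - 0) k * poch (1 + 0) k * poch (1 / 2 + α) k)) := by
    apply Finset.sum_congr rfl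
    intro k _
    simp only [add_zero, sub_zero]
    rw [← mul_div_assoc]
    congr 1 <;> ring
  have hG0 : ∀ k, GG 0 k = 1 := by
    intro k
    have hP : poch 1 k ≠ 0 := poch_ne_zero _ _ (fun i _ => one_add_ne i)
    unfold GG
    rw [sub_zero, add_zero, ← pow_two, div_self (pow_ne_zero 2 hP)]
  simp only [hG0] at w0
  rw [e0, w0]
  have : ∀ k, ZZ α (m + 1) k * xi (m + 1) k * (1 - GG (A * (m + 1)) k) =
    ZZ α (m + 1) k * xi (m + 1) k * 1 - ZZ α (m + 1) k * xi (m + 1) k * GG (A * (m + 1)) k := fun k => by ring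
  simp only [this]
  rw [Finset.sum_sub_distrib, mul_sub, mul_sub, ← w1]

lemma QH_mem (r k : ℕ) (hk : k < p ^ (r + 1)) : ((p : ℚ) ^ r) ^ 2 * H2 k ∈ RR p := by
  unfold H2
  rw [Finset.mul_sum]
  apply sum_mem
  intro j hj
  have hj := Finset.mem_Icc.1 hj
  have := q_div_mem (p := p) r j (by omega) (by omega)
  rw [mul_one_div, ← div_pow]
  exact pow_mem this 2

lemma QH_half (h5 : 5 ≤ p) (r k : ℕ) (hk : 2 * k + 1 = p ^ (r + 1)) :
    Dv p 1 (((p : ℚ) ^ r) ^ 2 * H2 k) := by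
  obtain ⟨h, hh⟩ := hp.out.odd_of_ne_two (by omega)
  have hQ : Odd (p ^ r) := (hp.out.odd_of_ne_two (by omega)).pow
  obtain ⟨g, hg⟩ := hQ
  have hd : k / p ^ r = h := by
    have : k = g + p ^ r * h := by
      have e : p ^ (r + 1) = p ^ r * p := pow_succ _ _
      rw [hh] at e hk
      rw [hh] at hg ⊢
      rw [e] at hk
      generalize (2 * h + 1) ^ r = Q at *
      have : 2 * k + 1 = 2 * (g + Q * h) + 1 := by
        rw [hk]
        linear_combination hg
      omega
    rw [this, Nat.add_mul_div_left _ _ (by omega), Nat.div_eq_of_lt (by omega), zero_add]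
  have h1 := H2_scale (p := p) r k
  rw [hd] at h1
  have := h1.add (H2_half h5 h hh)
  simpa using this

lemma main_bracket (h5 : 5 ≤ p) (r N n m : ℕ) (α A v : ℚ) (hA : A ∈ RR p) (hm : p ^ (r + 1) = m + 1)
    (hN : N < p ^ (r + 1)) (h1 : α + N = A * (p : ℚ) ^ (r + 1)) (hn : N / p ^ r = n)
    (hv : Dv p 1 (v - 1)) :
    Dv p 3 (v * (∑ k ∈ Finset.range (m + 1), ZZ α ((p : ℚ) ^ (r + 1)) k * xi ((p : ℚ) ^ (r + 1)) k *
      (1 - GG (A * (p : ℚ) ^ (r + 1)) k)) + A ^ 2 * (p : ℚ) ^ 2 * H2 n) := by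
  set q : ℚ := (p : ℚ) ^ (r + 1) with hq
  set Q : ℚ := (p : ℚ) ^ r with hQ
  have hqQ : q = Q * p := by rw [hq, hQ, pow_succ]
  have hvm := mem_of_one hv
  have hZ : ∀ k ∈ Finset.range (m + 1), ZZ α q k ∈ RR p := fun k hk =>
    ZZ_mem h5 (r + 1) N k α A hA hN (by rw [hm]; exact Finset.mem_range.1 hk) h1
  have hX : ∀ k ∈ Finset.range (m + 1), Dv p 1 (xi q k - 1) := fun k hk =>
    xi_one (r + 1) k (by rw [hm]; exact Finset.mem_range.1 hk)
  have hG : ∀ k ∈ Finset.range (m + 1), Dv p 3 (GG (A * q) k - 1 - (A * q) ^ 2 * H2 k) := fun k hk =>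
    (GG_congr (r + 1) k A hA (by rw [hm]; exact Finset.mem_range.1 hk)).2.2
  have hH : ∀ k ∈ Finset.range (m + 1), Q ^ 2 * H2 k ∈ RR p := fun k hk =>
    QH_mem r k (by rw [hm]; exact Finset.mem_range.1 hk)
  have hsum := zz_sum N m (by omega)
  have hS := H2_scale (p := p) r N
  rw [hn, ← hQ] at hS
  have inner : Dv p 1 (-(Q ^ 2 * H2 N - H2 n) +
      ∑ k ∈ Finset.range (m + 1), (zz N k - v * xi q k * ZZ α q k) * (Q ^ 2 * H2 k)) := by
    refine hS.neg.add (Dv.sum _ _ ?_)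
    intro k hk
    by_cases hne : 2 * k + 1 = p ^ (r + 1)
    · refine (QH_half h5 r k hne).mulL ?_
      exact sub_mem (zz_mem h5 _ _) (mul_mem (mul_mem hvm (mem_of_one (hX k hk))) (hZ k hk))
    · refine Dv.mulR ?_ (hH k hk)
      have h2 := ZZ_congr h5 (r + 1) N k α A hA hN (by rw [hm]; exact Finset.mem_range.1 hk) h1 hne
      have h3 := (one_mul_one hv (hX k hk)).mulR (hZ k hk)
      have := (h2.add h3).neg
      rw [← hq] at this
      convert this using 1
      ring
  have e : v * (∑ k ∈ Finset.range (m + 1), ZZ α q k * xi q k *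
      (1 - GG (A * q) k)) + A ^ 2 * (p : ℚ) ^ 2 * H2 n =
      (p : ℚ) ^ 2 * (-(Q ^ 2 * H2 N - H2 n) +
      ∑ k ∈ Finset.range (m + 1), (zz N k - v * xi q k * ZZ α q k) * (Q ^ 2 * H2 k)) * A ^ 2 +
      ∑ k ∈ Finset.range (m + 1), (GG (A * q) k - 1 - (A * q) ^ 2 * H2 k) *
        (-(v * (ZZ α q k * xi q k))) := by
    have e1 : Q ^ 2 * H2 N = ∑ k ∈ Finset.range (m + 1), zz N k * (Q ^ 2 * H2 k) := by
      rw [← hsum, Finset.mul_sum]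
      exact Finset.sum_congr rfl (fun k _ => by ring)
    have e2 : ∑ k ∈ Finset.range (m + 1), (zz N k - v * xi q k * ZZ α q k) * (Q ^ 2 * H2 k) =
      Q ^ 2 * H2 N - ∑ k ∈ Finset.range (m + 1), v * xi q k * ZZ α q k * (Q ^ 2 * H2 k) := by
      rw [e1, ← Finset.sum_sub_distrib]
      exact Finset.sum_congr rfl (fun k _ => by ring)
    have e3 : v * (∑ k ∈ Finset.range (m + 1), ZZ α q k * xi q k * (1 - GG (A * q) k)) =
      ∑ k ∈ Finset.range (m + 1), (GG (A * q) k - 1 - (A * q) ^ 2 * H2 k) *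
        (-(v * (ZZ α q k * xi q k))) - (p : ℚ) ^ 2 * A ^ 2 *
        ∑ k ∈ Finset.range (m + 1), v * xi q k * ZZ α q k * (Q ^ 2 * H2 k) := by
      rw [Finset.mul_sum, Finset.mul_sum, ← Finset.sum_sub_distrib]
      refine Finset.sum_congr rfl (fun k _ => ?_)
      have : (A * q) ^ 2 = A ^ 2 * Q ^ 2 * (p : ℚ) ^ 2 := by rw [hqQ]; ring
      rw [this]
      ring
    rw [e3, e2]
    ring
  rw [e]
  refine Dv.add (((Dv_pow 2).mul inner).mulR (pow_mem hA 2)) (Dv.sum _ _ ?_)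
  intro k hk
  exact (hG k hk).mulR (neg_mem (mul_mem hvm (mul_mem (hZ k hk) (mem_of_one (hX k hk)))))

end padic

theorem stmt0 (c d s : ℕ) (hc1 : 1 ≤ c) (hcd : c ≤ d) (hs1 : 1 ≤ s) (hsd : s ≤ d)
    (hd : 2 ≤ d) (hgcd : Nat.gcd (c * s) d = 1)
    (p : ℕ) (hp : p.Prime) (hp5 : 5 ≤ p) (hps : p ≡ s [MOD d])
    (α : ℚ) (hα : α = (c : ℚ) / d)
    (r : ℕ) (hr : 1 ≤ r)
    (hnd : ¬ ratCongr p 1 (dashIter p r (1/2 + α) * (1/2 + dashIter p r α)) 0)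
    (n : ℕ) (hn : (n : ℚ) = dashIter p r α * p - dashIter p (r - 1) α) :
    ratCongr p ((r : ℤ) + 3)
      (∑ k ∈ Finset.range (p ^ r),
        (2 * (k : ℚ) + α) * poch α k ^ 3 * poch (1/2) k /
          (poch 1 k ^ 3 * poch (1/2 + α) k))
      (dashIter p r α * (p : ℚ) ^ r -
        (dashIter p r α) ^ 3 / dashIter p r (1/2 + α) * (p : ℚ) ^ (r + 2) * H2 n) := by
  have : Fact p.Prime := ⟨hp⟩
  obtain ⟨r, rfl⟩ : ∃ r', r = r' + 1 := ⟨r - 1, by omega⟩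
  rw [Nat.add_sub_cancel] at hn
  have hcop : Nat.Coprime c d := Nat.Coprime.coprime_dvd_left (Dvd.intro _ rfl) hgcd
  have hscop : Nat.Coprime s d := Nat.Coprime.coprime_dvd_left (Dvd.intro_left _ rfl) hgcd
  have hclt : c < d := by
    rcases Nat.lt_or_ge c d with h | h
    · exact h
    · have : c = d := by omega
      subst this
      have : c = 1 := by simpa using hcop
      omega
  have hd0 : (0 : ℚ) < d := by
    have : 0 < d := by omega
    exact_mod_cast this
  have h0 : 0 < α := by
    have : (0 : ℚ) < c := by exact_mod_cast hc1
    rw [hα]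
    positivity
  have h1 : α < 1 := by
    rw [hα, div_lt_one hd0]
    exact_mod_cast hclt
  have hpd : ¬ p ∣ d := by
    intro hdv
    have hg : Nat.gcd p d = Nat.gcd s d := hps.gcd_eq
    rw [hscop, Nat.gcd_eq_left hdv] at hg
    omega
  have hαm : α ∈ RR p := by
    rw [hα, div_eq_mul_one_div]
    exact mul_mem (nat_mem c) (mem_inv_nat d hpd)
  have hhm : (1 / 2 : ℚ) ∈ RR p := half_mem hp5
  obtain ⟨hA, N, hN, hNe⟩ := dashIter_spec α hαm (r + 1)
  obtain ⟨hA', N', hN', hNe'⟩ := dashIter_spec α hαm r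
  obtain ⟨hB, M, hM, hMe⟩ := dashIter_spec (1 / 2 + α) (add_mem hhm hαm) (r + 1)
  set A := dashIter p (r + 1) α
  set A' := dashIter p r α
  set B := dashIter p (r + 1) (1 / 2 + α)
  have hBn : ¬ Dv p 1 B := by
    intro hb
    apply hnd
    have := ratCongr_of_Dv (p := p) (m := 1) (u := B * (1 / 2 + A)) (v := 0) (by
      rw [sub_zero]
      exact hb.mulR (add_mem hhm hA))
    exact_mod_cast this
  have hBi := inv_mem_of_not_Dv hB hBn
  have hB0 : B ≠ 0 := by
    intro hb
    apply hBn
    rw [hb]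
    exact Dv.zero 1
  have hNn : N / p ^ r = n := by
    have hpos : 0 < p ^ r := Nat.pow_pos hp.pos
    have : N = N' + p ^ r * n := by
      have : (N : ℚ) = N' + (p : ℚ) ^ r * n := by
        rw [hn]
        rw [pow_succ] at hNe
        linear_combination hNe - hNe'
      exact_mod_cast this
    rw [this, Nat.add_mul_div_left _ _ hpos, Nat.div_eq_of_lt hN', zero_add]
  obtain ⟨m, hm⟩ : ∃ m, p ^ (r + 1) = m + 1 :=
    ⟨p ^ (r + 1) - 1, by have : 0 < p ^ (r + 1) := Nat.pow_pos hp.pos; omega⟩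
  obtain ⟨v, hv, hC⟩ := Cc_eq hp5 (r + 1) N M α A B hA hB hB0 hN hM hNe hMe h0
  rw [show p ^ (r + 1) - 1 = m by omega] at hC
  have hmq : (p : ℚ) ^ (r + 1) = m + 1 := by exact_mod_cast hm
  have hS := S_diff α A B v ((p : ℚ) ^ (r + 1)) N m h0 h1 (by omega) hmq hNe hC
  have hbr := main_bracket hp5 r N n m α A v hA hm hN hNe hNn hv
  have hfin := ((Dv_pow (p := p) (r + 1)).mul hbr).mulR (mul_mem hA hBi)
  have := ratCongr_of_Dv (p := p) (m := r + 1 + 3) (u := ∑ k ∈ Finset.range (p ^ (r + 1)),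
        (2 * (k : ℚ) + α) * poch α k ^ 3 * poch (1/2) k /
          (poch 1 k ^ 3 * poch (1/2 + α) k)) (v := A * (p : ℚ) ^ (r + 1) -
        A ^ 3 / B * (p : ℚ) ^ (r + 1 + 2) * H2 n) (by
      convert hfin using 1
      rw [hm, ← sub_add, hS, pow_add (p : ℚ) (r + 1) 2]
      field_simp)
  exact_mod_cast this
end
end

section
/- Let c, d, s be positive integers with d ≥ 2, 1 ≤ c, s ≤ d and gcd(cs, d) = 1, and let p be a prime with p ≡ s (mod d). Then (c/d)* = ⟨s^{−1} c⟩_d / d, where s^{−1} denotes the inverse of s modulo d. -/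
noncomputable section

theorem stmt3 (c d s : ℕ) (hc1 : 1 ≤ c) (hcd : c ≤ d) (hs1 : 1 ≤ s) (hsd : s ≤ d)
    (hd : 2 ≤ d) (hgcd : Nat.gcd (c * s) d = 1)
    (p : ℕ) (hp : p.Prime) (hps : p ≡ s [MOD d]) :
    dash p ((c : ℚ) / d) = ((((s : ZMod d)⁻¹ * (c : ZMod d)).val : ℕ) : ℚ) / d := by
  have hco : Nat.Coprime (c * s) d := hgcd
  have hcc : Nat.Coprime c d := Nat.Coprime.coprime_mul_right hco
  have hsc : Nat.Coprime s d := Nat.Coprime.coprime_mul_left hco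
  have hpc : Nat.Coprime p d := by
    unfold Nat.Coprime
    rw [hps.gcd_eq]
    exact hsc
  have hlt : c < d := by
    rcases Nat.lt_or_ge c d with h | h
    · exact h
    · have : c = d := le_antisymm hcd h
      subst this
      simp at hcc
      omega
  haveI : Fact p.Prime := ⟨hp⟩
  haveI : NeZero d := ⟨by omega⟩
  have hd0 : (d : ℚ) ≠ 0 := by positivity
  have hp0 : (p : ℚ) ≠ 0 := by exact_mod_cast hp.ne_zero
  have hnd : (-((c : ℚ) / d)).num = -(c : ℤ) ∧ (-((c : ℚ) / d)).den = d := by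
    have h1 : ((c : ℚ) / d) = ((c : ℤ) : ℚ) / ((d : ℤ) : ℚ) := by push_cast; rfl
    have hdp : (0 : ℤ) < d := by omega
    have hco2 : Nat.Coprime (c : ℤ).natAbs (d : ℤ).natAbs := by simpa using hcc
    refine ⟨?_, ?_⟩
    · rw [Rat.num_neg_eq_neg_num, h1, Rat.num_div_eq_of_coprime hdp hco2]
    · rw [Rat.den_neg_eq_den, h1]
      exact_mod_cast Rat.den_div_eq_of_coprime hdp hco2
  set r := res p (-((c : ℚ) / d)) with hr
  have hrlt : r < p := ZMod.val_lt _
  have hdz : (d : ZMod p) ≠ 0 := by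
    rw [Ne, ZMod.natCast_eq_zero_iff]
    intro h
    have := Nat.Coprime.eq_one_of_dvd hpc h
    exact hp.one_lt.ne' this
  have hrc : (r : ZMod p) = -(c : ZMod p) * (d : ZMod p)⁻¹ := by
    rw [hr, res, hnd.1, hnd.2, ZMod.natCast_zmod_val]
    push_cast
    rfl
  have hdvd : p ∣ c + d * r := by
    rw [← ZMod.natCast_eq_zero_iff]
    push_cast
    rw [hrc]
    field_simp
    ring
  obtain ⟨t, ht⟩ := hdvd
  have htd : t < d := by
    have h1 : d * (r + 1) ≤ d * p := Nat.mul_le_mul_left d hrlt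
    have h2 : p * t < p * d := by
      rw [← ht]; nlinarith
    exact Nat.lt_of_mul_lt_mul_left h2
  have hpz : (p : ZMod d) = (s : ZMod d) := (ZMod.natCast_eq_natCast_iff _ _ _).2 hps
  have hmod : (c : ZMod d) = (s : ZMod d) * t := by
    have := congrArg (Nat.cast : ℕ → ZMod d) ht
    push_cast at this
    simpa [hpz] using this
  have hval : ((s : ZMod d)⁻¹ * (c : ZMod d)).val = t := by
    rw [hmod, ← mul_assoc, mul_comm (s : ZMod d)⁻¹, ZMod.coe_mul_inv_eq_one s hsc, one_mul,
      ZMod.val_natCast, Nat.mod_eq_of_lt htd]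
  have htq : (c : ℚ) + d * r = p * t := by exact_mod_cast ht
  rw [hval, dash, ← hr]
  field_simp
  linarith
end
end

section
/- Let c, d, s be positive integers with d ≥ 2, 1 ≤ c, s ≤ d and gcd(cs, d) = 1, and let p be a prime with p ≡ s (mod d). Then for every positive integer r, the r-fold iterate of Dwork's dash operation satisfies (c/d)^{*_r} = ⟨s^{−r} c⟩_d / d, where s^{−r} denotes the inverse of s^r modulo d. -/
noncomputable section

theorem dash_step (a d p : ℕ) (had : a < d) (hco : Nat.Coprime a d) (hp : p.Prime)
    (hpd : Nat.Coprime p d) :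
    ∃ b : ℕ, b < d ∧ Nat.Coprime b d ∧ dash p ((a : ℚ) / d) = (b : ℚ) / d ∧
      (b : ZMod d) * (p : ZMod d) = (a : ZMod d) := by
  have : Fact p.Prime := ⟨hp⟩
  have hd0 : 0 < d := by omega
  have hnum : ((a : ℚ) / d).num = a := by
    have := Rat.num_div_eq_of_coprime (a := (a : ℤ)) (b := (d : ℤ)) (by exact_mod_cast hd0)
      (by simpa using hco)
    simpa only [Int.cast_natCast, Nat.cast_inj] using this
  have hden : ((a : ℚ) / d).den = d := by
    have := Rat.den_div_eq_of_coprime (a := (a : ℤ)) (b := (d : ℤ)) (by exact_mod_cast hd0)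
      (by simpa using hco)
    simpa only [Int.cast_natCast, Nat.cast_inj] using this
  have hdz : (d : ZMod p) ≠ 0 := by
    rw [Ne, ZMod.natCast_eq_zero_iff]
    exact (Nat.Prime.coprime_iff_not_dvd hp).1 hpd
  obtain ⟨k, hk⟩ : ∃ k, k = res p (-((a : ℚ) / d)) := ⟨_, rfl⟩
  have hkp : k < p := by rw [hk]; exact ZMod.val_lt _
  have hkz : (k : ZMod p) = -(a : ZMod p) * (d : ZMod p)⁻¹ := by
    rw [hk, res, ZMod.natCast_zmod_val, Rat.neg_num, Rat.den_neg_eq_den, hnum, hden]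
    push_cast; rfl
  have hdvd : p ∣ a + k * d := by
    rw [← ZMod.natCast_eq_zero_iff]
    push_cast
    rw [hkz]
    field_simp
    ring
  obtain ⟨b, hb⟩ := hdvd
  have hbz : (b : ZMod d) * (p : ZMod d) = (a : ZMod d) := by
    have := congrArg (Nat.cast : ℕ → ZMod d) hb
    push_cast at this
    rw [ZMod.natCast_self] at this
    rw [mul_comm, ← this]; ring
  refine ⟨b, ?_, ?_, ?_, hbz⟩
  · have h1 : (k + 1) * d ≤ p * d := Nat.mul_le_mul_right d hkp
    have h2 : p * b < p * d := by rw [← hb]; nlinarith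
    exact Nat.lt_of_mul_lt_mul_left h2
  · have h : Nat.Coprime (a + k * d) d := by simpa using hco
    rw [hb] at h
    exact Nat.Coprime.coprime_mul_left h
  · rw [dash, ← hk]
    have hp0 : (p : ℚ) ≠ 0 := by exact_mod_cast hp.ne_zero
    have hd0' : (d : ℚ) ≠ 0 := by exact_mod_cast hd0.ne'
    have hbq : (a : ℚ) + k * d = p * b := by exact_mod_cast hb
    field_simp
    linarith

theorem stmt4 (c d s : ℕ) (hc1 : 1 ≤ c) (hcd : c ≤ d) (hs1 : 1 ≤ s) (hsd : s ≤ d)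
    (hd : 2 ≤ d) (hgcd : Nat.gcd (c * s) d = 1)
    (p : ℕ) (hp : p.Prime) (hps : p ≡ s [MOD d])
    (r : ℕ) (hr : 1 ≤ r) :
    dashIter p r ((c : ℚ) / d) =
      (((((s : ZMod d) ^ r)⁻¹ * (c : ZMod d)).val : ℕ) : ℚ) / d := by
  have hc : Nat.Coprime c d := Nat.Coprime.coprime_mul_right hgcd
  have hs : Nat.Coprime s d := Nat.Coprime.coprime_mul_left hgcd
  have hpd : Nat.Coprime p d := by
    have : Nat.gcd p d = Nat.gcd s d := hps.gcd_eq
    exact this.trans hs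
  have hpz : (p : ZMod d) = s := (ZMod.natCast_eq_natCast_iff _ _ _).2 hps
  have hlt : c < d := by
    rcases Nat.lt_or_eq_of_le hcd with h | h
    · exact h
    · subst h
      rw [Nat.coprime_self] at hc
      omega
  have key : ∀ n : ℕ, ∃ b : ℕ, b < d ∧ Nat.Coprime b d ∧
      dashIter p n ((c : ℚ) / d) = (b : ℚ) / d ∧ (b : ZMod d) * (s : ZMod d) ^ n = c := by
    intro n
    induction n with
    | zero => exact ⟨c, hlt, hc, rfl, by simp⟩
    | succ n ih =>
      obtain ⟨b, h1, h2, h3, h4⟩ := ih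
      obtain ⟨b', g1, g2, g3, g4⟩ := dash_step b d p h1 h2 hp hpd
      refine ⟨b', g1, g2, ?_, ?_⟩
      · rw [dashIter, Function.iterate_succ_apply', ← dashIter, h3, g3]
      · rw [← h4, ← g4, hpz]; ring
  obtain ⟨b, h1, h2, h3, h4⟩ := key r
  have hinv : (s : ZMod d) ^ r * ((s : ZMod d) ^ r)⁻¹ = 1 := by
    have := ZMod.coe_mul_inv_eq_one (n := d) (s ^ r) (Nat.Coprime.pow_left r hs)
    simpa using this
  have : ((s : ZMod d) ^ r)⁻¹ * (c : ZMod d) = b := by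
    rw [← h4]
    linear_combination (b : ZMod d) * hinv
  rw [h3, this, ZMod.val_natCast, Nat.mod_eq_of_lt h1]
end
end

section
/- Let c, d, s be positive integers with d ≥ 2, 1 ≤ c, s ≤ d and gcd(cs, d) = 1, let p be a prime with p ≡ s (mod d), and let r be a positive integer. Then ⟨−c/d⟩_{p^r} = (⟨s^{−r}c⟩_d · p^r − c)/d, and consequently (c/d)^{*_r} = (c/d + ⟨−c/d⟩_{p^r}) / p^r = ⟨s^{−r}c⟩_d / d. -/
noncomputable section

theorem res_key (m c d : ℕ) (hm : 1 ≤ m) (hd : 2 ≤ d) (hcd : c < d)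
    (hc : Nat.Coprime c d) (hmd : Nat.Coprime m d) :
    res m (-((c : ℚ) / d)) * d + c = ((m : ZMod d)⁻¹ * (c : ZMod d)).val * m := by
  haveI : NeZero m := ⟨by omega⟩
  haveI : NeZero d := ⟨by omega⟩
  have hnum : ((c : ℚ) / d).num = c := by
    have := Rat.num_div_eq_of_coprime (a := (c : ℤ)) (b := (d : ℤ)) (by omega) (by simpa using hc)
    simpa using this
  have hden : ((c : ℚ) / d).den = d := by
    have := Rat.den_div_eq_of_coprime (a := (c : ℤ)) (b := (d : ℤ)) (by omega) (by simpa using hc)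
    simp only [Int.cast_natCast] at this
    exact Int.ofNat.inj this
  have hlt : res m (-((c : ℚ) / d)) < m := ZMod.val_lt _
  have hcast : ((res m (-((c : ℚ) / d)) : ℕ) : ZMod m) * d + c = 0 := by
    unfold res
    rw [ZMod.natCast_zmod_val, Rat.neg_num, Rat.neg_den, hnum, hden, mul_assoc,
      mul_comm ((d : ZMod m)⁻¹), ZMod.coe_mul_inv_eq_one d hmd.symm]
    push_cast
    ring
  generalize res m (-((c : ℚ) / d)) = a at hlt hcast
  have hdvd : m ∣ a * d + c := by
    rw [← ZMod.natCast_eq_zero_iff]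
    exact_mod_cast hcast
  obtain ⟨k, hk⟩ := hdvd
  have hkd : k < d := by
    by_contra! h
    nlinarith [Nat.mul_le_mul_left m h, Nat.mul_le_mul_right d (Nat.succ_le_of_lt hlt)]
  have h2 : (c : ZMod d) = m * k := by
    have := congrArg (Nat.cast : ℕ → ZMod d) hk
    push_cast at this
    simpa using this
  rw [h2, ← mul_assoc, mul_comm ((m : ZMod d)⁻¹), ZMod.coe_mul_inv_eq_one m hmd, one_mul,
    ZMod.val_natCast_of_lt hkd, hk, mul_comm]

theorem dash_key (m c d : ℕ) (hm : 1 ≤ m) (hd : 2 ≤ d) (hcd : c < d)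
    (hc : Nat.Coprime c d) (hmd : Nat.Coprime m d) :
    ((c : ℚ) / d + (res m (-((c : ℚ) / d)) : ℚ)) / (m : ℚ)
      = (((m : ZMod d)⁻¹ * (c : ZMod d)).val : ℚ) / d := by
  have h := congrArg (Nat.cast : ℕ → ℚ) (res_key m c d hm hd hcd hc hmd)
  push_cast at h
  have h1 : (m : ℚ) ≠ 0 := by positivity
  have h2 : (d : ℚ) ≠ 0 := by positivity
  rw [div_eq_div_iff h1 h2, ← h, add_mul, div_mul_cancel₀ _ h2, add_comm]

theorem iter_key (c d p : ℕ) (hp : 1 ≤ p) (hd : 2 ≤ d) (hcd : c < d)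
    (hc : Nat.Coprime c d) (hpd : Nat.Coprime p d) (r : ℕ) :
    dashIter p r ((c : ℚ) / d) = ((((p : ZMod d) ^ r)⁻¹ * (c : ZMod d)).val : ℚ) / d := by
  haveI : NeZero d := ⟨by omega⟩
  induction r with
  | zero => simp [dashIter, ZMod.val_natCast_of_lt hcd]
  | succ r ih =>
    unfold dashIter at ih ⊢
    rw [Function.iterate_succ_apply', ih]
    unfold dash
    have hu : IsUnit (((p : ZMod d) ^ r)⁻¹ * (c : ZMod d)) := by
      have h1 : IsUnit (p : ZMod d) := (ZMod.isUnit_iff_coprime p d).2 hpd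
      have h2 : IsUnit (c : ZMod d) := (ZMod.isUnit_iff_coprime c d).2 hc
      refine IsUnit.mul ?_ h2
      exact IsUnit.of_mul_eq_one _ (ZMod.inv_mul_of_unit _ (h1.pow r))
    have hk : Nat.Coprime (((p : ZMod d) ^ r)⁻¹ * (c : ZMod d)).val d := by
      rw [← ZMod.isUnit_iff_coprime, ZMod.natCast_zmod_val]
      exact hu
    rw [dash_key p _ d hp hd (ZMod.val_lt _) hk hpd, ZMod.natCast_zmod_val, ← mul_assoc]
    have h1 : IsUnit (p : ZMod d) := (ZMod.isUnit_iff_coprime p d).2 hpd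
    have : (p : ZMod d)⁻¹ * ((p : ZMod d) ^ r)⁻¹ = ((p : ZMod d) ^ (r + 1))⁻¹ := by
      apply (h1.pow (r + 1)).mul_left_cancel
      rw [ZMod.mul_inv_of_unit _ (h1.pow (r + 1))]
      calc _ = ((p : ZMod d) * (p : ZMod d)⁻¹) * ((p : ZMod d) ^ r * ((p : ZMod d) ^ r)⁻¹) := by ring
        _ = 1 := by rw [ZMod.mul_inv_of_unit _ h1, ZMod.mul_inv_of_unit _ (h1.pow r), one_mul]
    rw [this]

theorem stmt6 (c d s : ℕ) (hc1 : 1 ≤ c) (hcd : c ≤ d) (hs1 : 1 ≤ s) (hsd : s ≤ d)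
    (hd : 2 ≤ d) (hgcd : Nat.gcd (c * s) d = 1)
    (p : ℕ) (hp : p.Prime) (hps : p ≡ s [MOD d])
    (r : ℕ) (hr : 1 ≤ r) :
    ((res (p ^ r) (-((c : ℚ) / d)) : ℚ) =
        (((((s : ZMod d) ^ r)⁻¹ * (c : ZMod d)).val : ℚ) * (p : ℚ) ^ r - c) / d) ∧
    dashIter p r ((c : ℚ) / d) =
        ((c : ℚ) / d + (res (p ^ r) (-((c : ℚ) / d)) : ℚ)) / (p : ℚ) ^ r ∧
    dashIter p r ((c : ℚ) / d) =
        (((((s : ZMod d) ^ r)⁻¹ * (c : ZMod d)).val : ℕ) : ℚ) / d := by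
  have hc : Nat.Coprime c d := Nat.Coprime.coprime_mul_right hgcd
  have hs : Nat.Coprime s d := Nat.Coprime.coprime_mul_left hgcd
  have hpd : Nat.Coprime p d := by
    have := hps.gcd_eq
    unfold Nat.Coprime at *
    rw [this, hs]
  have hcd' : c < d := by
    rcases hcd.lt_or_eq with h | h
    · exact h
    · subst h
      rw [Nat.coprime_self] at hc
      omega
  have hsp : (s : ZMod d) = p := ((ZMod.natCast_eq_natCast_iff _ _ _).2 hps).symm
  have hm : 1 ≤ p ^ r := Nat.one_le_pow _ _ hp.pos
  have h1 := res_key (p ^ r) c d hm hd hcd' hc (hpd.pow_left r)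
  have h2 := dash_key (p ^ r) c d hm hd hcd' hc (hpd.pow_left r)
  have h3 := iter_key c d p hp.pos hd hcd' hc hpd r
  rw [hsp]
  push_cast at h2
  refine ⟨?_, h3.trans h2.symm, h3⟩
  have h := congrArg (Nat.cast : ℕ → ℚ) h1
  push_cast at h
  have hd0 : (d : ℚ) ≠ 0 := by positivity
  rw [eq_div_iff hd0, ← h]
  ring
end
end
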